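/- arXiv:1804.00369 — 2 statements merged into one kernel-verified Lean document; each statement's English description precedes it below -/
import Mathlib

section
/- Let M be a real symmetric matrix whose diagonal entries are all 0 or −1 and whose off-diagonal entries are integers. If the smallest eigenvalue of M is less than −2, then M has a principal submatrix of order at most 10 with smallest eigenvalue less than −2. -/
open Matrix

section CriticalForm

variable {V : Type} [Fintype V] [DecidableEq V]

/-- The real symmetric bilinear form with integer Gram matrix `G`. -/
noncomputable def bil (G : V → V → ℤ) : LinearMap.BilinForm ℝ (V → ℝ) :=
  Matrix.toBilin' (Matrix.of fun i j => (G i j : ℝ))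

/-- The standard basis vector, with real entries. -/
def stdVec (a : V) : V → ℝ := Pi.single a 1

/-- A Gram matrix with diagonal `2` whose form is indefinite, while every proper principal
submatrix is positive semidefinite. -/
structure Critical (G : V → V → ℤ) : Prop where
  symm : ∀ i j, G i j = G j i
  diag : ∀ i, G i i = 2
  nonneg : ∀ x : V → ℝ, (∃ i, x i = 0) → 0 ≤ bil G x x
  neg : ∃ x : V → ℝ, bil G x x < 0

lemma bil_apply (G : V → V → ℤ) (x y : V → ℝ) :
    bil G x y = ∑ i, ∑ j, x i * G i j * y j := by
  simp [bil, Matrix.toBilin'_apply]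

lemma bil_comm {G : V → V → ℤ} (hG : ∀ i j, G i j = G j i) (x y : V → ℝ) :
    bil G x y = bil G y x := by
  rw [bil_apply, bil_apply, Finset.sum_comm]
  refine Finset.sum_congr rfl fun i _ => Finset.sum_congr rfl fun j _ => ?_
  rw [hG j i]; ring

lemma bil_stdVec (G : V → V → ℤ) (a : V) (y : V → ℝ) :
    bil G (stdVec a) y = ∑ j, G a j * y j := by
  rw [bil_apply, Finset.sum_eq_single a]
  · simp [stdVec]
  · intro b _ hb; simp [stdVec, hb]
  · simp

lemma bil_stdVec_stdVec (G : V → V → ℤ) (a b : V) :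
    bil G (stdVec a) (stdVec b) = G a b := by
  rw [bil_stdVec, Finset.sum_eq_single b]
  · simp [stdVec]
  · intro c _ hc; simp [stdVec, hc]
  · simp

lemma bil_add_smul {G : V → V → ℤ} (hG : ∀ i j, G i j = G j i) (x y : V → ℝ) (t : ℝ) :
    bil G (x + t • y) (x + t • y) = bil G x x + 2 * t * bil G x y + t ^ 2 * bil G y y := by
  simp only [map_add, map_smul, LinearMap.add_apply, LinearMap.smul_apply, smul_eq_mul]
  rw [bil_comm hG y x]; ring

/-- If `q + 2 t p + t² r ≥ 0` for all `t` and `q = 0`, then `p = 0`. -/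
lemma eq_zero_of_quadratic_nonneg {p r : ℝ} (h : ∀ t : ℝ, 0 ≤ 2 * t * p + t ^ 2 * r) :
    p = 0 := by
  have h0 : 0 < |r| + 1 := by positivity
  have h1 := h (-p / (|r| + 1))
  have h2 : 2 * (-p / (|r| + 1)) * p + (-p / (|r| + 1)) ^ 2 * r
      = p ^ 2 * (r - 2 * (|r| + 1)) / (|r| + 1) ^ 2 := by
    field_simp; ring
  rw [h2] at h1
  have h3 : 0 ≤ p ^ 2 * (r - 2 * (|r| + 1)) := by
    by_contra hc
    push Not at hc
    exact absurd h1 (not_le.mpr (div_neg_of_neg_of_pos hc (by positivity)))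
  have h4 : r ≤ |r| := le_abs_self r
  have h5 : p ^ 2 ≤ 0 := by nlinarith [sq_nonneg p, abs_nonneg r]
  nlinarith [sq_nonneg p]

namespace Critical

variable {G : V → V → ℤ}

lemma pos (h : Critical G) {i j : V} (hij : i ≠ j) {x : V → ℝ} (hi : x i = 0) (hj : x j = 0)
    (hx : x ≠ 0) : 0 < bil G x x := by
  refine lt_of_le_of_ne (h.nonneg x ⟨i, hi⟩) fun h0 => ?_
  have hk : ∀ k, bil G x (stdVec k) = 0 := by
    intro k
    refine eq_zero_of_quadratic_nonneg (r := bil G (stdVec k) (stdVec k)) fun t => ?_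
    have := h.nonneg (x + t • stdVec k) (by
      by_cases hki : k = i
      · exact ⟨j, by simp [stdVec, hj, hki, hij.symm]⟩
      · exact ⟨i, by simp [stdVec, hi, Ne.symm hki]⟩)
    rw [bil_add_smul h.symm, ← h0] at this
    linarith
  have hall : ∀ y, bil G y x = 0 := by
    intro y
    have hy : y = ∑ k, y k • stdVec k := by
      ext l; simp [stdVec, Finset.sum_apply, Pi.single_apply]
    rw [hy, map_sum, LinearMap.sum_apply]
    refine Finset.sum_eq_zero fun k _ => ?_
    rw [map_smul, LinearMap.smul_apply, bil_comm h.symm, hk, smul_zero]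
  obtain ⟨z, hz⟩ := h.neg
  obtain ⟨l, hl⟩ : ∃ l, x l ≠ 0 := by
    by_contra hc; push Not at hc; exact hx (funext hc)
  have := h.nonneg (z + (-(z l / x l)) • x) ⟨l, by simp; field_simp; ring⟩
  rw [bil_add_smul h.symm, ← h0, hall z] at this
  linarith

lemma exists_adj (h : Critical G) {T : Finset V} (hT : T.Nonempty) {b : V} (hb : b ∉ T) :
    ∃ a, a ∉ T ∧ ∃ t ∈ T, G a t ≠ 0 := by
  by_contra hc
  push Not at hc
  obtain ⟨z, hz⟩ := h.neg
  obtain ⟨t₀, ht₀⟩ := hT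
  set y : V → ℝ := fun i => if i ∈ T then z i else 0 with hy
  set w : V → ℝ := fun i => if i ∈ T then 0 else z i with hw
  have hzyw : z = y + (1 : ℝ) • w := by
    ext i; by_cases hi : i ∈ T <;> simp [hy, hw, hi]
  have hyw : bil G y w = 0 := by
    rw [bil_apply]
    refine Finset.sum_eq_zero fun i _ => Finset.sum_eq_zero fun j _ => ?_
    by_cases hi : i ∈ T
    · by_cases hj : j ∈ T
      · simp [hw, hj]
      · rw [h.symm i j, hc j hj i hi]; simp
    · simp [hy, hi]
  rw [hzyw, bil_add_smul h.symm, hyw] at hz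
  have h1 := h.nonneg y ⟨b, by simp [hy, hb]⟩
  have h2 := h.nonneg w ⟨t₀, by simp [hw, ht₀]⟩
  linarith

end Critical

/-- The image in coordinates of a combination of the vectors `u i`. -/
def ev {ι : Type} (u : V → ι → ℤ) (x : V → ℝ) (k : ι) : ℝ := ∑ i, x i * (u i k : ℝ)

section Representation

variable {ι : Type} [Fintype ι] {G : V → V → ℤ} {T : Finset V} {u : V → ι → ℤ}

lemma bil_eq_of_gram (hu : ∀ s ∈ T, ∀ t ∈ T, ∑ k, u s k * u t k = G s t) {x y : V → ℝ}
    (hx : ∀ i, i ∉ T → x i = 0) (hy : ∀ i, i ∉ T → y i = 0) :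
    bil G x y = ∑ k, ev u x k * ev u y k := by
  simp only [ev, Finset.sum_mul_sum]
  rw [bil_apply, Finset.sum_comm]
  rw [Finset.sum_comm]
  rw [Finset.sum_comm (s := (Finset.univ : Finset ι))]
  refine Finset.sum_congr rfl fun i _ => ?_
  rw [Finset.sum_comm (s := (Finset.univ : Finset ι))]
  refine Finset.sum_congr rfl fun j _ => ?_
  by_cases hi : i ∈ T
  · by_cases hj : j ∈ T
    · rw [← hu i hi j hj]
      push_cast
      rw [Finset.mul_sum, Finset.sum_mul]
      exact Finset.sum_congr rfl fun k _ => by ring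
    · simp [hy j hj]
  · simp [hx i hi]

lemma bil_stdVec_eq {a : V} {α : ι → ℝ} (hα : ∀ t ∈ T, ∑ k, α k * (u t k : ℝ) = G a t)
    {y : V → ℝ} (hy : ∀ i, i ∉ T → y i = 0) :
    bil G (stdVec a) y = ∑ k, α k * ev u y k := by
  simp only [ev, Finset.mul_sum]
  rw [bil_stdVec, Finset.sum_comm]
  refine Finset.sum_congr rfl fun i _ => ?_
  by_cases hi : i ∈ T
  · rw [← hα i hi, Finset.sum_mul]
    exact Finset.sum_congr rfl fun k _ => by ring
  · simp [hy i hi]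

omit [Fintype ι] in
lemma exists_coeff_of_mem_span {z : ι → ℤ} (hz : z ∈ Submodule.span ℤ (u '' (T : Set V))) :
    ∃ x : V → ℤ, (∀ i, i ∉ T → x i = 0) ∧ ∀ k, ∑ i, x i * u i k = z k := by
  induction hz using Submodule.span_induction with
  | mem z hz =>
    obtain ⟨t, ht, rfl⟩ := hz
    refine ⟨Pi.single t 1, fun i hi => ?_, fun k => ?_⟩
    · have : i ≠ t := by rintro rfl; exact hi (by simpa using ht)
      simp [this]
    · rw [Finset.sum_eq_single t] <;> simp +contextual
  | zero => exact ⟨0, by simp, by simp⟩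
  | add z w _ _ hz hw =>
    obtain ⟨x, hx, hx'⟩ := hz
    obtain ⟨y, hy, hy'⟩ := hw
    refine ⟨x + y, fun i hi => by simp [hx i hi, hy i hi], fun k => ?_⟩
    simp [add_mul, Finset.sum_add_distrib, hx', hy']
  | smul c z _ hz =>
    obtain ⟨x, hx, hx'⟩ := hz
    refine ⟨c • x, fun i hi => by simp [hx i hi], fun k => ?_⟩
    simp [mul_assoc, ← Finset.mul_sum, hx']

/-- A functional prescribed on an independent family is given by a vector. -/
lemma exists_functional (hinj : ∀ x : V → ℝ, (∀ i, i ∉ T → x i = 0) → (∀ k, ev u x k = 0) → x = 0)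
    (g : V → ℝ) : ∃ α : ι → ℝ, ∀ t ∈ T, ∑ k, α k * (u t k : ℝ) = g t := by
  classical
  let L : (T → ℝ) →ₗ[ℝ] (ι → ℝ) :=
    ∑ t : T, (LinearMap.proj t).smulRight (fun k => (u t k : ℝ))
  have hL : ∀ x k, L x k = ∑ t : T, x t * (u t k : ℝ) := by
    intro x k; simp [L]
  have hker : LinearMap.ker L = ⊥ := by
    rw [LinearMap.ker_eq_bot']
    intro x hx
    let x' : V → ℝ := fun i => if hi : i ∈ T then x ⟨i, hi⟩ else 0
    have h0 : x' = 0 := by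
      refine hinj x' (fun i hi => by simp [x', hi]) fun k => ?_
      have := congrFun hx k
      rw [hL] at this
      rw [ev, ← Finset.sum_subset (Finset.subset_univ T) (fun i _ hi => by simp [x', hi]),
        ← Finset.sum_coe_sort]
      simpa [x'] using this
    ext t
    have := congrFun h0 t
    simpa [x'] using this
  obtain ⟨L', hL'⟩ := L.exists_leftInverse_of_injective hker
  let f : (ι → ℝ) →ₗ[ℝ] ℝ := (∑ t : T, (g t) • LinearMap.proj t) ∘ₗ L'
  refine ⟨fun k => f (Pi.single k 1), fun t ht => ?_⟩
  have h1 : f (L (Pi.single ⟨t, ht⟩ 1)) = g t := by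
    have : L' (L (Pi.single ⟨t, ht⟩ 1)) = Pi.single ⟨t, ht⟩ 1 := LinearMap.congr_fun hL' _
    simp only [f, LinearMap.comp_apply, this]
    simp [Pi.single_apply]
  have h2 : L (Pi.single ⟨t, ht⟩ 1) = ∑ k, (u t k : ℝ) • Pi.single k (1 : ℝ) := by
    ext k
    rw [hL, Finset.sum_apply]
    simp [Pi.single_apply]
  rw [← h1, h2, map_sum]
  exact Finset.sum_congr rfl fun k _ => by rw [map_smul, smul_eq_mul, mul_comm]

omit [Fintype V] [DecidableEq V] in
lemma exists_int_of_mem_span {g : V → ℤ} {α : ι → ℝ}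
    (hα : ∀ t ∈ T, ∑ k, α k * (u t k : ℝ) = g t)
    {z : ι → ℤ} (hz : z ∈ Submodule.span ℤ (u '' (T : Set V))) :
    ∃ n : ℤ, ∑ k, α k * (z k : ℝ) = n := by
  induction hz using Submodule.span_induction with
  | mem z hz =>
    obtain ⟨t, ht, rfl⟩ := hz
    exact ⟨g t, hα t (by simpa using ht)⟩
  | zero => exact ⟨0, by simp⟩
  | add z w _ _ hz hw =>
    obtain ⟨x, hx⟩ := hz
    obtain ⟨y, hy⟩ := hw
    exact ⟨x + y, by simp [mul_add, Finset.sum_add_distrib, hx, hy]⟩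
  | smul c z _ hz =>
    obtain ⟨x, hx⟩ := hz
    refine ⟨c * x, ?_⟩
    push_cast
    rw [← hx, Finset.mul_sum]
    exact Finset.sum_congr rfl fun k _ => by simp; ring

lemma ev_injective (h : Critical G) {i j : V} (hij : i ≠ j) (hi : i ∉ T) (hj : j ∉ T)
    (hu : ∀ s ∈ T, ∀ t ∈ T, ∑ k, u s k * u t k = G s t) (x : V → ℝ)
    (hx : ∀ i, i ∉ T → x i = 0) (hx0 : ∀ k, ev u x k = 0) : x = 0 := by
  by_contra hne
  have := h.pos hij (hx i hi) (hx j hj) hne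
  rw [bil_eq_of_gram hu hx hx] at this
  simp [hx0] at this

end Representation

end CriticalForm

lemma quadratic_det_le {P Q R : ℝ} (h : ∀ s r : ℝ, 0 ≤ P * s ^ 2 + 2 * Q * s * r + R * r ^ 2) :
    Q ^ 2 ≤ P * R := by
  have hP : 0 ≤ P := by simpa using h 1 0
  rcases hP.eq_or_lt with h0 | h0
  · have : Q = 0 := eq_zero_of_quadratic_nonneg (r := R) fun t => by
      have := h 1 t; rw [← h0] at this; linarith
    rw [this, ← h0]; simp
  · have h1 := h (-Q) P
    have h2 : 0 ≤ P * (P * R - Q ^ 2) := by linarith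
    nlinarith [nonneg_of_mul_nonneg_right h2 h0]

lemma quadratic_nonneg {P Q R : ℝ} (hP : 0 ≤ P) (hR : 0 ≤ R) (h : Q ^ 2 ≤ P * R) (s r : ℝ) :
    0 ≤ P * s ^ 2 + 2 * Q * s * r + R * r ^ 2 := by
  rcases hP.eq_or_lt with h0 | h0
  · have : Q = 0 := by rw [← h0] at h; nlinarith
    rw [this, ← h0]; simp; positivity
  · have : 0 ≤ P * (P * s ^ 2 + 2 * Q * s * r + R * r ^ 2) := by
      nlinarith [sq_nonneg (P * s + Q * r), mul_nonneg (sub_nonneg.mpr h) (sq_nonneg r)]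
    exact nonneg_of_mul_nonneg_right this h0

lemma residual_det_le {A B g v w : ℤ} (hA : 0 ≤ A) (hA2 : A ≤ 2) (hB : 0 ≤ B) (hB2 : B ≤ 2)
    (hv : |v| ≤ A) (hw : |w| ≤ B) {m : ℝ} (hm : 9 ≤ m)
    (h : ∀ s r : ℝ, 0 ≤ (2 - A) * s ^ 2 + 2 * g * s * r + (2 - B) * r ^ 2
      + (s * v + r * w) ^ 2 / m) :
    g ^ 2 ≤ (2 - A) * (2 - B) := by
  have h1 : ∀ s r : ℝ, 0 ≤ (9 * (2 - A) + v ^ 2 : ℝ) * s ^ 2 + 2 * (9 * g + v * w) * s * r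
      + (9 * (2 - B) + w ^ 2) * r ^ 2 := by
    intro s r
    have h2 := h s r
    have h3 : (s * v + r * w) ^ 2 / m ≤ (s * v + r * w) ^ 2 / 9 :=
      div_le_div_of_nonneg_left (sq_nonneg _) (by norm_num) hm
    nlinarith
  have h2 := quadratic_det_le h1
  have h3 : (9 * g + v * w) ^ 2 ≤ (9 * (2 - A) + v ^ 2) * (9 * (2 - B) + w ^ 2) := by
    exact_mod_cast h2
  rw [abs_le] at hv hw
  have hg : -2 ≤ g ∧ g ≤ 2 := by
    have e1 : 9 * (2 - A) + v ^ 2 ≤ 22 := by nlinarith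
    have e2 : 9 * (2 - B) + w ^ 2 ≤ 22 := by nlinarith
    have e3 : (9 * g + v * w) ^ 2 ≤ 22 ^ 2 := h3.trans (by nlinarith [sq_nonneg v, sq_nonneg w])
    have e4 := abs_le_of_sq_le_sq' e3 (by norm_num)
    have e5 : v * w ≤ 4 := by nlinarith
    have e6 : -4 ≤ v * w := by nlinarith
    constructor <;> omega
  obtain ⟨hg1, hg2⟩ := hg
  obtain ⟨hv1, hv2⟩ := hv
  obtain ⟨hw1, hw2⟩ := hw
  interval_cases A <;> interval_cases B <;> interval_cases v <;> interval_cases w <;>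
    interval_cases g <;> solve | norm_num | (exfalso; revert h3; norm_num)

/-- A middle cut of a path closed up to a cycle by a vector of norm `2`. -/
lemma middle_cut_absurd {B g v₁ v₂ w₁ w₂ : ℤ} (hB2 : B ≤ 2)
    (hv₁ : v₁ ^ 2 = 1) (hv₂ : v₂ ^ 2 = 1) (hw : |w₁| + |w₂| ≤ B) (hg : g ≠ 0)
    (h : ∀ s r : ℝ, 0 ≤ 2 * g * s * r + (2 - B) * r ^ 2
      + (s * v₁ + r * w₁) ^ 2 / 5 + (s * v₂ + r * w₂) ^ 2 / 5) : False := by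
  have hv₁' : (v₁ : ℝ) ^ 2 = 1 := by exact_mod_cast hv₁
  have hv₂' : (v₂ : ℝ) ^ 2 = 1 := by exact_mod_cast hv₂
  have h1 : ∀ s r : ℝ, 0 ≤ (2 : ℝ) * s ^ 2 + 2 * (5 * g + v₁ * w₁ + v₂ * w₂) * s * r
      + (5 * (2 - B) + w₁ ^ 2 + w₂ ^ 2) * r ^ 2 := by
    intro s r
    have h2 := h s r
    have e : (2 : ℝ) * s ^ 2 + 2 * (5 * g + v₁ * w₁ + v₂ * w₂) * s * r
      + (5 * (2 - B) + w₁ ^ 2 + w₂ ^ 2) * r ^ 2 = 5 * (2 * g * s * r + (2 - B) * r ^ 2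
      + (s * v₁ + r * w₁) ^ 2 / 5 + (s * v₂ + r * w₂) ^ 2 / 5)
      + (1 - (v₁ : ℝ) ^ 2) * s ^ 2 + (1 - (v₂ : ℝ) ^ 2) * s ^ 2 := by ring
    rw [e, hv₁', hv₂']; linarith
  have h2 := quadratic_det_le h1
  have h3 : (5 * g + v₁ * w₁ + v₂ * w₂) ^ 2 ≤ 2 * (5 * (2 - B) + w₁ ^ 2 + w₂ ^ 2) := by
    exact_mod_cast h2
  have a1 := abs_le.mp (show |w₁| ≤ 2 by linarith [abs_nonneg w₂])
  have a2 := abs_le.mp (show |w₂| ≤ 2 by linarith [abs_nonneg w₁])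
  have hB0 : 0 ≤ B := by linarith [abs_nonneg w₁, abs_nonneg w₂]
  have c1 : v₁ = 1 ∨ v₁ = -1 := sq_eq_one_iff.mp hv₁
  have c2 : v₂ = 1 ∨ v₂ = -1 := sq_eq_one_iff.mp hv₂
  obtain ⟨a11, a12⟩ := a1
  obtain ⟨a21, a22⟩ := a2
  have hg2 : -2 ≤ g ∧ g ≤ 2 := by
    have e3 : (5 * g + v₁ * w₁ + v₂ * w₂) ^ 2 ≤ 6 ^ 2 := h3.trans (by nlinarith)
    have e4 := abs_le_of_sq_le_sq' e3 (by norm_num)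
    rcases c1 with rfl | rfl <;> rcases c2 with rfl | rfl <;> constructor <;> omega
  obtain ⟨hg1, hg2⟩ := hg2
  rcases c1 with rfl | rfl <;> rcases c2 with rfl | rfl <;> interval_cases g <;>
    first
    | exact hg rfl
    | (interval_cases B <;> interval_cases w₁ <;> interval_cases w₂ <;>
        solve | (exfalso; revert hw; norm_num) | (revert h3; norm_num))

section SmallVectors

variable {ι : Type} [Fintype ι]

lemma sq_le_one_of_sum_sq_le {γ : ι → ℤ} (h : ∑ k, γ k ^ 2 ≤ 3) (i : ι) :
    γ i = 0 ∨ γ i = 1 ∨ γ i = -1 := by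
  have h1 : γ i ^ 2 ≤ 3 :=
    (Finset.single_le_sum (fun k _ => sq_nonneg (γ k)) (Finset.mem_univ i)).trans h
  have h2 : γ i ≤ 1 := by nlinarith
  have h3 : -1 ≤ γ i := by nlinarith
  omega

lemma card_support_eq_sum_sq {γ : ι → ℤ} (h : ∑ k, γ k ^ 2 ≤ 3) :
    ((Finset.univ.filter fun k => γ k ≠ 0).card : ℤ) = ∑ k, γ k ^ 2 := by
  rw [Finset.card_filter]
  push_cast
  refine Finset.sum_congr rfl fun k _ => ?_
  rcases sq_le_one_of_sum_sq_le h k with h | h | h <;> simp [h]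

lemma int_abs_le_sq (a : ℤ) : |a| ≤ a ^ 2 := by
  rw [← sq_abs]
  rcases (abs_nonneg a).eq_or_lt with h | h
  · rw [← h]; simp
  · nlinarith

lemma abs_sum_le_sum_sq (γ : ι → ℤ) : |∑ k, γ k| ≤ ∑ k, γ k ^ 2 := by
  refine (Finset.abs_sum_le_sum_abs _ _).trans (Finset.sum_le_sum fun k _ => ?_)
  exact int_abs_le_sq (γ k)

lemma abs_dot_le_sum_sq {σ γ : ι → ℤ} (hσ : ∀ k, |σ k| ≤ 1) :
    |∑ k, σ k * γ k| ≤ ∑ k, γ k ^ 2 := by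
  refine (Finset.abs_sum_le_sum_abs _ _).trans (Finset.sum_le_sum fun k _ => ?_)
  rw [abs_mul]
  have := int_abs_le_sq (γ k)
  nlinarith [hσ k, abs_nonneg (γ k)]

variable [DecidableEq ι]

lemma eq_single_of_sum_sq_eq_one {γ : ι → ℤ} (h : ∑ k, γ k ^ 2 = 1) :
    ∃ i ε, (ε = 1 ∨ ε = -1) ∧ γ = Pi.single i ε := by
  have h1 := card_support_eq_sum_sq (γ := γ) (by omega)
  rw [h] at h1
  obtain ⟨i, hi⟩ := Finset.card_eq_one.mp (by exact_mod_cast h1)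
  have hi0 : γ i ≠ 0 := by
    have : i ∈ Finset.univ.filter fun k => γ k ≠ 0 := by rw [hi]; simp
    simpa using this
  refine ⟨i, γ i, ?_, ?_⟩
  · rcases sq_le_one_of_sum_sq_le (γ := γ) (by omega) i with h | h <;> tauto
  · ext k
    by_cases hk : k = i
    · subst hk; simp
    · have : k ∉ Finset.univ.filter fun k => γ k ≠ 0 := by rw [hi]; simpa using hk
      simp only [Finset.mem_filter, Finset.mem_univ, true_and, not_not] at this
      simp [hk, this]

lemma eq_single_add_single_of_sum_sq_eq_two {γ : ι → ℤ} (h : ∑ k, γ k ^ 2 = 2) :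
    ∃ i j ε η, i ≠ j ∧ (ε = 1 ∨ ε = -1) ∧ (η = 1 ∨ η = -1) ∧
      γ = Pi.single i ε + Pi.single j η := by
  have h1 := card_support_eq_sum_sq (γ := γ) (by omega)
  rw [h] at h1
  obtain ⟨i, j, hij, hs⟩ := Finset.card_eq_two.mp (by exact_mod_cast h1)
  have hmem : ∀ k, γ k ≠ 0 ↔ k = i ∨ k = j := by
    intro k
    have : k ∈ Finset.univ.filter (fun k => γ k ≠ 0) ↔ k = i ∨ k = j := by rw [hs]; simp
    simpa using this
  have hi0 := (hmem i).mpr (Or.inl rfl)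
  have hj0 := (hmem j).mpr (Or.inr rfl)
  refine ⟨i, j, γ i, γ j, hij, ?_, ?_, ?_⟩
  · rcases sq_le_one_of_sum_sq_le (γ := γ) (by omega) i with h | h <;> tauto
  · rcases sq_le_one_of_sum_sq_le (γ := γ) (by omega) j with h | h <;> tauto
  · ext k
    by_cases hki : k = i
    · subst hki; simp [hij]
    · by_cases hkj : k = j
      · subst hkj; simp [hki]
      · have : γ k = 0 := by
          by_contra hc; rcases (hmem k).mp hc with h | h <;> contradiction
        simp [hki, hkj, this]

end SmallVectors

section Shift

variable {ι : Type} [Fintype ι]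

/-- Rounding the mean to zero. -/
lemma exists_int_shift [Nonempty ι] {α : ι → ℝ} (hα : ∀ i j, ∃ n : ℤ, α i - α j = n) :
    ∃ (γ : ι → ℤ) (s : ℝ), (∀ i, α i = γ i + s) ∧ 2 * |∑ k, γ k| ≤ Fintype.card ι := by
  obtain ⟨i₀⟩ := ‹Nonempty ι›
  choose d hd using fun i => hα i i₀
  set m : ℤ := (Fintype.card ι : ℤ) with hm
  have hm0 : 0 < m := by
    have : 0 < Fintype.card ι := Fintype.card_pos_iff.mpr ⟨i₀⟩
    rw [hm]; exact_mod_cast this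
  set D := ∑ k, d k with hD
  set q := (2 * D + m) / (2 * m) with hq
  refine ⟨fun k => d k - q, α i₀ + q, fun i => ?_, ?_⟩
  · push_cast; rw [← hd]; ring
  · have e : ∑ k, (d k - q) = D - m * q := by
      rw [Finset.sum_sub_distrib]; simp [hD, hm]
    rw [e]
    have h1 := Int.mul_ediv_add_emod (2 * D + m) (2 * m)
    have h2 := Int.emod_nonneg (2 * D + m) (show 2 * m ≠ 0 by omega)
    have h3 := Int.emod_lt_of_pos (2 * D + m) (show 0 < 2 * m by omega)
    rw [← hq] at h1
    have : |2 * (D - m * q)| ≤ m := abs_le.mpr ⟨by linarith, by linarith⟩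
    rwa [abs_mul, abs_two] at this

lemma sum_sq_le_four {γ : ι → ℤ} (hs : 2 * |∑ k, γ k| ≤ Fintype.card ι)
    (h : (Fintype.card ι : ℤ) * ∑ k, γ k ^ 2 - (∑ k, γ k) ^ 2 ≤ 2 * Fintype.card ι)
    (hpos : 0 < Fintype.card ι) : ∑ k, γ k ^ 2 ≤ 4 := by
  have h1 := abs_sum_le_sum_sq γ
  set S := ∑ k, γ k
  set N := ∑ k, γ k ^ 2
  set m : ℤ := (Fintype.card ι : ℤ) with hm
  have hm0 : 0 < m := by rw [hm]; exact_mod_cast hpos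
  by_contra hc
  have h2 : 2 * S ^ 2 ≤ m * N := by
    rw [← sq_abs]; nlinarith [abs_nonneg S]
  nlinarith

end Shift

section RootLatticeRepresentations

variable {V : Type} [Fintype V] [DecidableEq V] {ι : Type} [Fintype ι]

/-- The Gram matrix on `T` is that of a basis `u` of the root lattice of type `A`. -/
structure ARep (G : V → V → ℤ) (T : Finset V) (u : V → ι → ℤ) : Prop where
  card : Fintype.card ι = T.card + 1
  sum_zero : ∀ t ∈ T, ∑ k, u t k = 0
  gram : ∀ s ∈ T, ∀ t ∈ T, ∑ k, u s k * u t k = G s t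
  span : ∀ z : ι → ℤ, ∑ k, z k = 0 → z ∈ Submodule.span ℤ (u '' (T : Set V))

/-- The Gram matrix on `T` is that of a basis `u` of the root lattice of type `D`. -/
structure DRep (G : V → V → ℤ) (T : Finset V) (u : V → ι → ℤ) : Prop where
  card : Fintype.card ι = T.card
  four_le : 4 ≤ T.card
  gram : ∀ s ∈ T, ∀ t ∈ T, ∑ k, u s k * u t k = G s t
  span : ∀ z : ι → ℤ, Even (∑ k, z k) → z ∈ Submodule.span ℤ (u '' (T : Set V))

variable {G : V → V → ℤ} {T : Finset V} {u : V → ι → ℤ}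

/-- The coordinate vectors of the real combinations of the family `u` on `T`. -/
def evRange (T : Finset V) (u : V → ι → ℤ) : Submodule ℝ (ι → ℝ) where
  carrier := {z | ∃ y : V → ℝ, (∀ i, i ∉ T → y i = 0) ∧ ∀ k, ev u y k = z k}
  add_mem' := by
    rintro z w ⟨y, hy, hz⟩ ⟨x, hx, hw⟩
    refine ⟨y + x, fun i hi => by simp [hy i hi, hx i hi], fun k => ?_⟩
    rw [Pi.add_apply, ← hz, ← hw]
    simp [ev, add_mul, Finset.sum_add_distrib]
  zero_mem' := ⟨0, by simp, by simp [ev]⟩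
  smul_mem' := by
    rintro c z ⟨y, hy, hz⟩
    refine ⟨c • y, fun i hi => by simp [hy i hi], fun k => ?_⟩
    rw [Pi.smul_apply, ← hz]
    simp [ev, mul_assoc, Finset.mul_sum]

omit [Fintype ι] in
lemma cast_mem_evRange {z : ι → ℤ} (hz : z ∈ Submodule.span ℤ (u '' (T : Set V))) :
    (fun k => (z k : ℝ)) ∈ evRange T u := by
  obtain ⟨x, hx, hxz⟩ := exists_coeff_of_mem_span hz
  refine ⟨fun i => x i, fun i hi => by simp [hx i hi], fun k => ?_⟩
  change _ = ((z k : ℤ) : ℝ)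
  rw [← hxz]; simp [ev]

lemma ARep.mem_evRange [DecidableEq ι] (hA : ARep G T u) {z : ι → ℝ} (hz : ∑ k, z k = 0) :
    z ∈ evRange T u := by
  by_cases hne : Nonempty ι
  · obtain ⟨i₀⟩ := hne
    have : z = ∑ i, z i • fun k => ((Pi.single i 1 - Pi.single i₀ 1 : ι → ℤ) k : ℝ) := by
      ext k
      simp only [Finset.sum_apply, Pi.smul_apply, smul_eq_mul, Pi.sub_apply, Int.cast_sub,
        mul_sub, Finset.sum_sub_distrib, ← Finset.sum_mul, hz]
      simp [Pi.single_apply]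
    rw [this]
    exact Submodule.sum_mem _ fun i _ => Submodule.smul_mem _ _
      (cast_mem_evRange (hA.span _ (by simp [Finset.sum_sub_distrib])))
  · rw [show z = 0 from funext fun k => (hne ⟨k⟩).elim]
    exact zero_mem _

lemma DRep.mem_evRange [DecidableEq ι] (hD : DRep G T u) (z : ι → ℝ) : z ∈ evRange T u := by
  have : z = ∑ i, (z i / 2) • fun k => ((Pi.single i 2 : ι → ℤ) k : ℝ) := by
    ext k
    simp [Finset.sum_apply, Pi.single_apply]
  rw [this]
  exact Submodule.sum_mem _ fun i _ => Submodule.smul_mem _ _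
    (cast_mem_evRange (hD.span _ (by simp)))

/-- Expansion of the form on one extra vector. -/
lemma bil_stdVec_sub {a : V} (hG : ∀ i j, G i j = G j i) (hd : G a a = 2)
    (hu : ∀ s ∈ T, ∀ t ∈ T, ∑ k, u s k * u t k = G s t)
    {α : ι → ℝ} (hα : ∀ t ∈ T, ∑ k, α k * (u t k : ℝ) = G a t)
    {y : V → ℝ} (hy : ∀ i, i ∉ T → y i = 0) :
    bil G (stdVec a + (-1 : ℝ) • y) (stdVec a + (-1 : ℝ) • y)
      = 2 - 2 * ∑ k, α k * ev u y k + ∑ k, ev u y k ^ 2 := by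
  rw [bil_add_smul hG, bil_stdVec_stdVec, hd, bil_stdVec_eq hα hy, bil_eq_of_gram hu hy hy]
  simp only [← sq]
  push_cast; ring

lemma Critical.two_sub_pos (h : Critical G) {a b : V} (hab : a ≠ b) (ha : a ∉ T) (hb : b ∉ T)
    {c : V} (hac : a ≠ c) (hbc : b ≠ c) (hc : c ∉ T)
    (hu : ∀ s ∈ T, ∀ t ∈ T, ∑ k, u s k * u t k = G s t)
    {α : ι → ℝ} (hα : ∀ t ∈ T, ∑ k, α k * (u t k : ℝ) = G a t)
    {z : ι → ℝ} (hz : z ∈ evRange T u) :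
    0 < 2 - 2 * ∑ k, α k * z k + ∑ k, z k ^ 2 := by
  obtain ⟨y, hy, hyz⟩ := hz
  have := bil_stdVec_sub h.symm (h.diag a) hu hα hy
  simp only [hyz] at this
  rw [← this]
  refine h.pos hbc ?_ ?_ ?_
  · simp [stdVec, hab.symm, hy b hb]
  · simp [stdVec, hac.symm, hy c hc]
  · intro h0
    have := congrFun h0 a
    simp [stdVec, hy a ha] at this

lemma Critical.two_sub_nonneg (h : Critical G) {a b : V} (hab : a ≠ b) (hb : b ∉ T)
    (hu : ∀ s ∈ T, ∀ t ∈ T, ∑ k, u s k * u t k = G s t)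
    {α : ι → ℝ} (hα : ∀ t ∈ T, ∑ k, α k * (u t k : ℝ) = G a t)
    {z : ι → ℝ} (hz : z ∈ evRange T u) :
    0 ≤ 2 - 2 * ∑ k, α k * z k + ∑ k, z k ^ 2 := by
  obtain ⟨y, hy, hyz⟩ := hz
  have := bil_stdVec_sub h.symm (h.diag a) hu hα hy
  simp only [hyz] at this
  rw [← this]
  exact h.nonneg _ ⟨b, by simp [stdVec, hab.symm, hy b hb]⟩

omit [Fintype V] [DecidableEq V] in
/-- In type `A` the functional of an extra vector is integral up to a shift. -/
lemma ARep.exists_int_functional [DecidableEq ι] [Nonempty ι] (hA : ARep G T u) {a : V}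
    {α : ι → ℝ} (hα : ∀ t ∈ T, ∑ k, α k * (u t k : ℝ) = G a t) :
    ∃ γ : ι → ℤ, (∀ t ∈ T, ∑ k, γ k * u t k = G a t) ∧ 2 * |∑ k, γ k| ≤ Fintype.card ι := by
  obtain ⟨γ, s, hγ, hS⟩ := exists_int_shift (α := α) fun i j => by
    obtain ⟨n, hn⟩ := exists_int_of_mem_span hα
      (hA.span (Pi.single i 1 - Pi.single j 1) (by simp [Finset.sum_sub_distrib]))
    refine ⟨n, ?_⟩
    rw [← hn]
    simp [mul_sub, Finset.sum_sub_distrib, Pi.single_apply]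
  refine ⟨γ, fun t ht => ?_, hS⟩
  have h1 := hα t ht
  have h2 : ∑ k, (u t k : ℝ) = 0 := by exact_mod_cast hA.sum_zero t ht
  simp only [hγ, add_mul, Finset.sum_add_distrib, ← Finset.mul_sum, h2] at h1
  have : ∑ k, (γ k : ℝ) * (u t k : ℝ) = (G a t : ℝ) := by linarith
  exact_mod_cast this

omit [Fintype V] [DecidableEq V] in
lemma cast_functional {a : V} {γ : ι → ℤ} (hγ : ∀ t ∈ T, ∑ k, γ k * u t k = G a t) :
    ∀ t ∈ T, ∑ k, (γ k : ℝ) * (u t k : ℝ) = (G a t : ℝ) := fun t ht => by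
  exact_mod_cast hγ t ht

/-- Evaluation of the bound at the centred functional. -/
lemma sum_centred (γ : ι → ℤ) [Nonempty ι] :
    ∃ z : ι → ℝ, ∑ k, z k = 0 ∧ 2 - 2 * ∑ k, (γ k : ℝ) * z k + ∑ k, z k ^ 2
      = (2 * Fintype.card ι - (Fintype.card ι * ∑ k, γ k ^ 2 - (∑ k, γ k) ^ 2) : ℤ)
        / (Fintype.card ι : ℝ) := by
  have hm : (Fintype.card ι : ℝ) ≠ 0 := by
    exact_mod_cast Fintype.card_ne_zero
  set S : ℝ := ∑ k, (γ k : ℝ) with hS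
  refine ⟨fun k => γ k - S / Fintype.card ι, ?_, ?_⟩
  · rw [Finset.sum_sub_distrib]
    simp [← hS]; field_simp; simp
  · have e1 : ∑ k, (γ k : ℝ) * (γ k - S / Fintype.card ι)
        = ∑ k, (γ k : ℝ) ^ 2 - S ^ 2 / Fintype.card ι := by
      simp only [mul_sub, Finset.sum_sub_distrib, ← Finset.sum_mul, ← hS, ← sq]
      ring
    have e2 : ∑ k, ((γ k : ℝ) - S / Fintype.card ι) ^ 2
        = ∑ k, (γ k : ℝ) ^ 2 - S ^ 2 / Fintype.card ι := by
      simp only [sub_sq, Finset.sum_add_distrib, Finset.sum_sub_distrib, ← Finset.sum_mul,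
        ← Finset.mul_sum, ← hS]
      simp; field_simp; ring
    rw [e1, e2]
    push_cast
    rw [← hS]
    field_simp; ring

end RootLatticeRepresentations

section Growth

variable {V : Type} [Fintype V] [DecidableEq V] {ι : Type}
variable {G : V → V → ℤ} {T : Finset V} {u : V → ι → ℤ}

/-- Adjoin to the family `u` the vector at `a` with coordinates `γ` and new coordinate `c`. -/
def extendRep (u : V → ι → ℤ) (a : V) (γ : ι → ℤ) (c : ℤ) (v : V) (o : Option ι) : ℤ :=
  if v = a then o.elim c γ else o.elim 0 (u v)

/-- Extension of an integer vector by zero. -/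
def extendZero : (ι → ℤ) →ₗ[ℤ] (Option ι → ℤ) where
  toFun z o := o.elim 0 z
  map_add' z w := by ext o; cases o <;> simp
  map_smul' c z := by ext o; cases o <;> simp

omit [Fintype V] in
lemma extendRep_self (a : V) (γ : ι → ℤ) (c : ℤ) :
    extendRep u a γ c a = fun o => o.elim c γ := by
  ext o; simp [extendRep]

omit [Fintype V] in
lemma extendRep_of_ne {a v : V} (h : v ≠ a) (γ : ι → ℤ) (c : ℤ) :
    extendRep u a γ c v = extendZero (u v) := by
  ext o; simp [extendRep, h, extendZero]

omit [Fintype V] in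
lemma extendRep_mem_span (a : V) (γ : ι → ℤ) (c : ℤ) :
    (fun o => o.elim c γ : Option ι → ℤ) ∈
      Submodule.span ℤ (extendRep u a γ c '' (insert a T : Finset V)) :=
  Submodule.subset_span ⟨a, by simp, extendRep_self a γ c⟩

omit [Fintype V] in
lemma extendZero_mem_span {a : V} (ha : a ∉ T) (γ : ι → ℤ) (c : ℤ) {z : ι → ℤ}
    (hz : z ∈ Submodule.span ℤ (u '' (T : Set V))) :
    extendZero z ∈ Submodule.span ℤ (extendRep u a γ c '' (insert a T : Finset V)) := by
  have h1 := Submodule.mem_map_of_mem (f := extendZero) hz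
  rw [Submodule.map_span] at h1
  refine Submodule.span_mono ?_ h1
  rintro _ ⟨_, ⟨t, ht, rfl⟩, rfl⟩
  have hta : t ≠ a := by rintro rfl; exact ha (by simpa using ht)
  exact ⟨t, by simp at ht; simp [ht], extendRep_of_ne hta γ c⟩

variable [Fintype ι]

omit [Fintype V] in
lemma gram_insert {κ : Type} [Fintype κ] {w : V → κ → ℤ} (hG : ∀ i j, G i j = G j i) {a : V}
    (hT : ∀ s ∈ T, ∀ t ∈ T, ∑ k, w s k * w t k = G s t)
    (haa : ∑ k, w a k * w a k = G a a) (hat : ∀ t ∈ T, ∑ k, w a k * w t k = G a t) :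
    ∀ s ∈ insert a T, ∀ t ∈ insert a T, ∑ k, w s k * w t k = G s t := by
  intro s hs t ht
  rcases Finset.mem_insert.mp hs with hs | hs <;> rcases Finset.mem_insert.mp ht with ht | ht
  · rw [hs, ht]; exact haa
  · rw [hs]; exact hat t ht
  · rw [ht, hG, ← hat s hs]; exact Finset.sum_congr rfl fun k _ => mul_comm _ _
  · exact hT s hs t ht

omit [Fintype V] in
lemma gram_extendRep (hG : ∀ i j, G i j = G j i) {a : V} (hd : G a a = 2) (ha : a ∉ T)
    (hu : ∀ s ∈ T, ∀ t ∈ T, ∑ k, u s k * u t k = G s t) {γ : ι → ℤ} {c : ℤ}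
    (hγ : ∀ t ∈ T, ∑ k, γ k * u t k = G a t) (hn : ∑ k, γ k ^ 2 + c ^ 2 = 2) :
    ∀ s ∈ insert a T, ∀ t ∈ insert a T,
      ∑ o, extendRep u a γ c s o * extendRep u a γ c t o = G s t := by
  have hne : ∀ t ∈ T, t ≠ a := by rintro t ht rfl; exact ha ht
  refine gram_insert hG (fun s hs t ht => ?_) ?_ (fun t ht => ?_)
  · rw [Fintype.sum_option]
    simp [extendRep, hne s hs, hne t ht, hu s hs t ht]
  · rw [Fintype.sum_option, hd, ← hn]
    simp [extendRep, sq, add_comm]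
  · rw [Fintype.sum_option]
    simp [extendRep, hne t ht, hγ t ht]

variable [DecidableEq ι]

omit [Fintype V] in
lemma ARep.extend (hA : ARep G T u) (hG : ∀ i j, G i j = G j i) {a : V} (hd : G a a = 2)
    (ha : a ∉ T) {i : ι} {ε : ℤ} (hε : ε = 1 ∨ ε = -1)
    (hγ : ∀ t ∈ T, ∑ k, (Pi.single i ε : ι → ℤ) k * u t k = G a t) :
    ARep G (insert a T) (extendRep u a (Pi.single i ε) (-ε)) where
  card := by rw [Fintype.card_option, Finset.card_insert_of_notMem ha, hA.card]
  sum_zero t ht := by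
    rw [Fintype.sum_option]
    by_cases hta : t = a
    · simp [extendRep, hta]
    · simp [extendRep, hta, hA.sum_zero t (Finset.mem_of_mem_insert_of_ne ht hta)]
  gram := gram_extendRep hG hd ha hA.gram hγ (by
    rw [Finset.sum_eq_single i (by simp +contextual) (by simp)]
    rcases hε with rfl | rfl <;> simp)
  span z hz := by
    rw [Fintype.sum_option] at hz
    have hε2 : ε * ε = 1 := by rcases hε with rfl | rfl <;> simp
    have : z = extendZero ((fun k => z (some k)) + Pi.single i (z none))
        + (-(z none) * ε) • (fun o => o.elim (-ε) (Pi.single i ε) : Option ι → ℤ) := by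
      ext o
      cases o with
      | none => simp [extendZero, mul_assoc, hε2]
      | some k =>
        by_cases hk : k = i
        · subst hk; simp [extendZero, mul_assoc, hε2]
        · simp [extendZero, hk]
    rw [this]
    refine Submodule.add_mem _ (extendZero_mem_span ha _ _ (hA.span _ ?_))
      (Submodule.smul_mem _ _ (extendRep_mem_span _ _ _))
    simp [Finset.sum_add_distrib]; linarith

omit [Fintype V] in
lemma DRep.extend (hD : DRep G T u) (hG : ∀ i j, G i j = G j i) {a : V} (hd : G a a = 2)
    (ha : a ∉ T) {i : ι} {ε : ℤ} (hε : ε = 1 ∨ ε = -1)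
    (hγ : ∀ t ∈ T, ∑ k, (Pi.single i ε : ι → ℤ) k * u t k = G a t) :
    DRep G (insert a T) (extendRep u a (Pi.single i ε) 1) where
  card := by rw [Fintype.card_option, Finset.card_insert_of_notMem ha, hD.card]
  four_le := by rw [Finset.card_insert_of_notMem ha]; have := hD.four_le; omega
  gram := gram_extendRep hG hd ha hD.gram hγ (by
    rw [Finset.sum_eq_single i (by simp +contextual) (by simp)]
    rcases hε with rfl | rfl <;> simp)
  span z hz := by
    rw [Fintype.sum_option] at hz
    have : z = extendZero ((fun k => z (some k)) - Pi.single i (z none * ε))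
        + (z none) • (fun o => o.elim 1 (Pi.single i ε) : Option ι → ℤ) := by
      ext o
      cases o with
      | none => simp [extendZero]
      | some k =>
        by_cases hk : k = i
        · subst hk; simp [extendZero]
        · simp [extendZero, hk]
    rw [this]
    refine Submodule.add_mem _ (extendZero_mem_span ha _ _ (hD.span _ ?_))
      (Submodule.smul_mem _ _ (extendRep_mem_span _ _ _))
    simp only [Pi.sub_apply, Finset.sum_sub_distrib, Finset.sum_pi_single', Finset.mem_univ,
      if_true]
    rcases hε with rfl | rfl
    · rw [Int.even_add] at hz; simp only [mul_one]; rw [Int.even_sub, hz]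
    · rw [Int.even_add] at hz; simp [Int.even_add, hz]

omit [Fintype V] [DecidableEq ι] in
lemma ARep.toDRep (hA : ARep G T u) (hG : ∀ i j, G i j = G j i) {a : V} (hd : G a a = 2)
    (ha : a ∉ T) {γ : ι → ℤ} {σ : ℤ} (hσ : σ = 1 ∨ σ = -1) (hS : ∑ k, γ k = 2 * σ)
    (hN : ∑ k, γ k ^ 2 = 2) (h4 : 4 ≤ Fintype.card ι)
    (hγ : ∀ t ∈ T, ∑ k, γ k * u t k = G a t) :
    DRep G (insert a T) (Function.update u a γ) := by
  have hne : ∀ t ∈ T, t ≠ a := by rintro t ht rfl; exact ha ht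
  refine ⟨?_, ?_, ?_, ?_⟩
  · rw [Finset.card_insert_of_notMem ha, hA.card]
  · rw [Finset.card_insert_of_notMem ha, ← hA.card]; exact h4
  · refine gram_insert hG (fun s hs t ht => ?_) ?_ (fun t ht => ?_)
    · simp [hne s hs, hne t ht, hA.gram s hs t ht]
    · simp [hd, ← sq, hN]
    · simp [hne t ht, hγ t ht]
  · rintro z ⟨p, hp⟩
    have h1 : z - (p * σ) • γ ∈ Submodule.span ℤ (u '' (T : Set V)) := by
      refine hA.span _ ?_
      simp only [Pi.sub_apply, Pi.smul_apply, smul_eq_mul, Finset.sum_sub_distrib,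
        ← Finset.mul_sum, hp, hS]
      rcases hσ with rfl | rfl <;> ring
    have h2 : Submodule.span ℤ (u '' (T : Set V)) ≤
        Submodule.span ℤ (Function.update u a γ '' (insert a T : Finset V)) := by
      refine Submodule.span_mono ?_
      rintro _ ⟨t, ht, rfl⟩
      simp only [Finset.mem_coe] at ht
      exact ⟨t, by simp [ht], by simp [hne t ht]⟩
    have h3 : γ ∈ Submodule.span ℤ (Function.update u a γ '' (insert a T : Finset V)) :=
      Submodule.subset_span ⟨a, by simp, by simp⟩
    have := Submodule.add_mem _ (h2 h1) (Submodule.smul_mem _ (p * σ) h3)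
    simpa using this

/-- The functional of a vector extending a type `A` representation. -/
lemma ARep.functional_cases (h : Critical G) (hA : ARep G T u) {a b c : V} (ha : a ∉ T)
    (hb : b ∉ T) (hc : c ∉ T) (hab : a ≠ b) (hac : a ≠ c) (hbc : b ≠ c)
    (hadj : ∃ t ∈ T, G a t ≠ 0) :
    ∃ γ : ι → ℤ, (∀ t ∈ T, ∑ k, γ k * u t k = G a t) ∧
      ((∃ i ε, (ε = 1 ∨ ε = -1) ∧ γ = Pi.single i ε) ∨
       (∃ σ, (σ = 1 ∨ σ = -1) ∧ ∑ k, γ k = 2 * σ ∧ ∑ k, γ k ^ 2 = 2 ∧ 4 ≤ Fintype.card ι) ∨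
       (∃ σ : ℤ, ∃ K : Finset ι, (σ = 1 ∨ σ = -1) ∧ K.card = 3 ∧
        (∀ k, γ k = if k ∈ K then σ else 0) ∧ 6 ≤ Fintype.card ι ∧ Fintype.card ι ≤ 8)) := by
  have hne : Nonempty ι := by
    rw [← Fintype.card_pos_iff, hA.card]; omega
  obtain ⟨α, hα⟩ := exists_functional (ev_injective h hab ha hb hA.gram) (fun t => (G a t : ℝ))
  obtain ⟨γ, hγ, hS⟩ := hA.exists_int_functional hα
  refine ⟨γ, hγ, ?_⟩
  obtain ⟨z, hz0, hz⟩ := sum_centred γ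
  have h1 := h.two_sub_pos hab ha hb hac hbc hc hA.gram (cast_functional hγ)
    (hA.mem_evRange hz0)
  rw [hz] at h1
  have hm : (0 : ℝ) < Fintype.card ι := by exact_mod_cast Fintype.card_pos
  have h2 : (0 : ℤ) < 2 * Fintype.card ι - (Fintype.card ι * ∑ k, γ k ^ 2 - (∑ k, γ k) ^ 2) := by
    have := (div_pos_iff_of_pos_right hm).mp h1
    exact_mod_cast this
  have h4 := sum_sq_le_four hS (by linarith) Fintype.card_pos
  have habs := abs_sum_le_sum_sq γ
  have hN0 : 0 ≤ ∑ k, γ k ^ 2 := Finset.sum_nonneg fun k _ => sq_nonneg _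
  have hm' : (0 : ℤ) < Fintype.card ι := by exact_mod_cast Fintype.card_pos
  have hpar : Even (∑ k, γ k ^ 2 - ∑ k, γ k) := by
    rw [← Finset.sum_sub_distrib]
    refine Finset.even_sum _ fun k _ => ?_
    rw [show γ k ^ 2 - γ k = (γ k - 1) * (γ k - 1 + 1) by ring]
    exact Int.even_mul_succ_self _
  generalize hNN : ∑ k, γ k ^ 2 = N at *
  generalize hSS : ∑ k, γ k = S at *
  generalize hmm : (Fintype.card ι : ℤ) = m at *
  have hS2 : 4 * S ^ 2 ≤ m ^ 2 := by
    rw [← sq_abs S]; nlinarith [abs_nonneg S]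
  have hmnat : Fintype.card ι = m.toNat := by omega
  rw [abs_le] at habs
  obtain ⟨habs1, habs2⟩ := habs
  have hN : N = 0 ∨ N = 1 ∨ N = 2 ∨ N = 3 ∨ N = 4 := by omega
  rcases hN with rfl | rfl | rfl | rfl | rfl
  · exfalso
    obtain ⟨t, ht, hGt⟩ := hadj
    refine hGt ?_
    rw [← hγ t ht]
    refine Finset.sum_eq_zero fun k _ => ?_
    have := (Finset.sum_eq_zero_iff_of_nonneg fun k _ => sq_nonneg (γ k)).mp hNN k
      (Finset.mem_univ k)
    have h0 : γ k = 0 := by simpa using this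
    simp [h0]
  · left; exact eq_single_of_sum_sq_eq_one hNN
  · right; left
    have : S = -2 ∨ S = 0 ∨ S = 2 := by
      obtain ⟨p, hp⟩ := hpar; omega
    rcases this with rfl | rfl | rfl
    · refine ⟨-1, by simp, by simp, rfl, ?_⟩
      norm_num at hS; omega
    · exfalso; omega
    · refine ⟨1, by simp, by simp, rfl, ?_⟩
      norm_num at hS; omega
  · right; right
    have hS' : S = -3 ∨ S = 3 := by
      obtain ⟨p, hp⟩ := hpar
      have : S = -3 ∨ S = -1 ∨ S = 1 ∨ S = 3 := by omega
      rcases this with rfl | rfl | rfl | rfl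
      · simp
      · exfalso; omega
      · exfalso; omega
      · simp
    have hm9 : m < 9 := by rcases hS' with rfl | rfl <;> omega
    have hm6 : 6 ≤ m := by rcases hS' with rfl | rfl <;> norm_num at hS <;> omega
    have hcard := card_support_eq_sum_sq (γ := γ) (by omega)
    rw [hNN] at hcard
    obtain ⟨σ, hσ, hσS⟩ : ∃ σ : ℤ, (σ = 1 ∨ σ = -1) ∧ S = 3 * σ := by
      rcases hS' with rfl | rfl
      · exact ⟨-1, by simp, by simp⟩
      · exact ⟨1, by simp, by simp⟩
    refine ⟨σ, Finset.univ.filter fun k => γ k ≠ 0, hσ, by exact_mod_cast hcard, fun k => ?_,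
      by omega, by omega⟩
    have hz : ∑ k, (γ k ^ 2 - σ * γ k) = 0 := by
      rw [Finset.sum_sub_distrib, ← Finset.mul_sum, hNN, hSS, hσS]
      rcases hσ with rfl | rfl <;> norm_num
    have hz2 := (Finset.sum_eq_zero_iff_of_nonneg fun k _ => ?_).mp hz k (Finset.mem_univ k)
    · by_cases hk : γ k = 0
      · simp [hk]
      · have : γ k * (γ k - σ) = 0 := by linarith
        simp only [Finset.mem_filter, Finset.mem_univ, true_and, ne_eq, hk, not_false_iff,
          if_true]
        rcases mul_eq_zero.mp this with h | h
        · contradiction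
        · omega
    · rcases sq_le_one_of_sum_sq_le (γ := γ) (by omega) k with h | h | h <;>
        rcases hσ with rfl | rfl <;> simp [h]
  · exfalso
    have : S ^ 2 ≤ 16 := by nlinarith
    nlinarith
end Growth

section GrowthD

variable {V : Type} [Fintype V] [DecidableEq V] {ι : Type} [Fintype ι] [DecidableEq ι]
variable {G : V → V → ℤ} {T : Finset V} {u : V → ι → ℤ}

omit [Fintype V] [DecidableEq V] in
/-- In type `D` a functional is integral or half-integral. -/
lemma DRep.functional_half (hD : DRep G T u) {g : V → ℤ} {α : ι → ℝ}
    (hα : ∀ t ∈ T, ∑ k, α k * (u t k : ℝ) = g t) :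
    (∃ γ : ι → ℤ, ∀ k, α k = γ k) ∨ ∃ n : ι → ℤ, (∀ k, Odd (n k)) ∧ ∀ k, α k = n k / 2 := by
  have h1 : ∀ i, ∃ n : ℤ, α i = n / 2 := by
    intro i
    obtain ⟨n, hn⟩ := exists_int_of_mem_span hα (hD.span (Pi.single i 2) (by simp))
    refine ⟨n, ?_⟩
    rw [← hn]; simp [Pi.single_apply]
  have h2 : ∀ i j, ∃ n : ℤ, α i - α j = n := by
    intro i j
    obtain ⟨n, hn⟩ := exists_int_of_mem_span hα
      (hD.span (Pi.single i 1 - Pi.single j 1) (by simp [Finset.sum_sub_distrib]))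
    refine ⟨n, ?_⟩
    rw [← hn]; simp [mul_sub, Finset.sum_sub_distrib, Pi.single_apply]
  choose n hn using h1
  by_cases hodd : ∀ k, Odd (n k)
  · exact Or.inr ⟨n, hodd, hn⟩
  · left
    push Not at hodd
    obtain ⟨i, hi⟩ := hodd
    obtain ⟨p, hp⟩ := Int.not_odd_iff_even.mp hi
    have h3 : ∀ j, ∃ q : ℤ, α j = q := by
      intro j
      obtain ⟨q, hq⟩ := h2 j i
      refine ⟨q + p, ?_⟩
      have : α i = p := by rw [hn i, hp]; push_cast; ring
      push_cast
      linarith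
    choose γ hγ using h3
    exact ⟨γ, hγ⟩

omit [Fintype ι] [DecidableEq ι] in
lemma one_le_sq_of_odd {n : ℤ} (h : Odd n) : 1 ≤ n ^ 2 := by
  have : n ≠ 0 := by rintro rfl; simp at h
  have := Int.one_le_abs this
  rw [← sq_abs]; nlinarith

lemma DRep.functional_cases (h : Critical G) (hD : DRep G T u) {a b c : V} (ha : a ∉ T)
    (hb : b ∉ T) (hc : c ∉ T) (hab : a ≠ b) (hac : a ≠ c) (hbc : b ≠ c)
    (hadj : ∃ t ∈ T, G a t ≠ 0) :
    (∃ i ε, (ε = 1 ∨ ε = -1) ∧ ∀ t ∈ T, ∑ k, (Pi.single i ε : ι → ℤ) k * u t k = G a t) ∨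
    (Fintype.card ι ≤ 7 ∧ ∃ ε : ι → ℤ, (∀ k, ε k = 1 ∨ ε k = -1) ∧
      ∀ t ∈ T, ∑ k, ε k * u t k = 2 * G a t) := by
  obtain ⟨α, hα⟩ := exists_functional (ev_injective h hab ha hb hD.gram) (fun t => (G a t : ℝ))
  have h1 := h.two_sub_pos hab ha hb hac hbc hc hD.gram hα (hD.mem_evRange α)
  have h2 : ∑ k, α k ^ 2 < 2 := by
    simp only [← sq] at h1; linarith
  rcases hD.functional_half (g := G a) hα with ⟨γ, hγ⟩ | ⟨n, hn, hαn⟩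
  · left
    have hγ' : ∀ t ∈ T, ∑ k, γ k * u t k = G a t := by
      intro t ht
      have := hα t ht
      simp only [hγ] at this
      exact_mod_cast this
    have h3 : ∑ k, γ k ^ 2 < 2 := by
      simp only [hγ] at h2
      exact_mod_cast h2
    have hN0 : 0 ≤ ∑ k, γ k ^ 2 := Finset.sum_nonneg fun k _ => sq_nonneg _
    have hN : ∑ k, γ k ^ 2 = 0 ∨ ∑ k, γ k ^ 2 = 1 := by omega
    rcases hN with hN | hN
    · exfalso
      obtain ⟨t, ht, hGt⟩ := hadj
      refine hGt ?_
      rw [← hγ' t ht]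
      refine Finset.sum_eq_zero fun k _ => ?_
      have := (Finset.sum_eq_zero_iff_of_nonneg fun k _ => sq_nonneg (γ k)).mp hN k
        (Finset.mem_univ k)
      have h0 : γ k = 0 := by simpa using this
      simp [h0]
    · obtain ⟨i, ε, hε, rfl⟩ := eq_single_of_sum_sq_eq_one hN
      exact ⟨i, ε, hε, hγ'⟩
  · right
    have h3 : ∑ k, n k ^ 2 < 8 := by
      have : ∑ k, α k ^ 2 = (∑ k, (n k : ℝ) ^ 2) / 4 := by
        rw [Finset.sum_div]; exact Finset.sum_congr rfl fun k _ => by rw [hαn]; ring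
      rw [this] at h2
      have h5 : ∑ k, (n k : ℝ) ^ 2 < 8 := by linarith
      exact_mod_cast h5
    have h4 : (Fintype.card ι : ℤ) ≤ ∑ k, n k ^ 2 := by
      have : ∑ _k : ι, (1 : ℤ) ≤ ∑ k, n k ^ 2 :=
        Finset.sum_le_sum fun k _ => one_le_sq_of_odd (hn k)
      simpa using this
    refine ⟨by omega, n, fun k => ?_, fun t ht => ?_⟩
    · have h5 : n k ^ 2 < 8 := lt_of_le_of_lt
        (Finset.single_le_sum (fun k _ => sq_nonneg (n k)) (Finset.mem_univ k)) h3
      have h6 : n k ≤ 2 := by nlinarith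
      have h7 : -2 ≤ n k := by nlinarith
      obtain ⟨p, hp⟩ := hn k
      omega
    · have := hα t ht
      simp only [hαn] at this
      have h5 : ∑ k, (n k : ℝ) * (u t k : ℝ) = 2 * (G a t : ℝ) := by
        rw [← this, Finset.mul_sum]
        exact Finset.sum_congr rfl fun k _ => by ring
      exact_mod_cast h5

omit [Fintype V] [DecidableEq V] in
/-- Triality: in type `D₄` a half-integral functional becomes a coordinate functional after a
reflection. -/
lemma DRep.exists_reflect (hD : DRep G T u) (h4 : Fintype.card ι = 4) {a : V} {ε : ι → ℤ}
    (hε : ∀ k, ε k = 1 ∨ ε k = -1) (ha : ∀ t ∈ T, ∑ k, ε k * u t k = 2 * G a t) :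
    ∃ u' : V → ι → ℤ, DRep G T u' ∧ ∃ i η, (η = 1 ∨ η = -1) ∧
      ∀ t ∈ T, ∑ k, (Pi.single i η : ι → ℤ) k * u' t k = G a t := by
  obtain ⟨i⟩ : Nonempty ι := by rw [← Fintype.card_pos_iff]; omega
  set η := ε i with hη
  set ρ : ι → ℤ := fun k => ε k - 2 * (Pi.single i η : ι → ℤ) k with hρ
  have hρ1 : ∀ k, ρ k = 1 ∨ ρ k = -1 := by
    intro k
    by_cases hk : k = i
    · subst hk; rcases hε k with h | h <;> simp [hρ, hη, h]
    · simpa [hρ, hk] using hε k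
  have hρi : ρ i = -η := by simp [hρ, ← hη]; ring
  have hηη : η * η = 1 := by rcases hε i with h | h <;> simp [hη, h]
  have hρρ : ∑ k, ρ k * ρ k = 4 := by
    have : ∀ k, ρ k * ρ k = 1 := fun k => by rcases hρ1 k with h | h <;> simp [h]
    simp [this, h4]
  have hρodd : ∀ k, Odd (ρ k) := fun k => by rcases hρ1 k with h | h <;> simp [h]
  set c : V → ℤ := fun t => G a t - η * u t i with hc
  have huρ : ∀ t ∈ T, ∑ k, u t k * ρ k = 2 * c t := by
    intro t ht
    have h1 : ∑ k, (Pi.single i η : ι → ℤ) k * u t k = η * u t i := by simp [Pi.single_apply]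
    rw [show ∑ k, u t k * ρ k = ∑ k, ε k * u t k - 2 * ∑ k, (Pi.single i η : ι → ℤ) k * u t k from ?_,
      ha t ht, h1, hc]
    · ring
    · rw [Finset.mul_sum, ← Finset.sum_sub_distrib]
      exact Finset.sum_congr rfl fun k _ => by simp only [hρ]; ring
  refine ⟨fun t k => u t k - c t * ρ k, ⟨hD.card, hD.four_le, fun s hs t ht => ?_, fun v hv => ?_⟩,
    i, η, hε i, fun t ht => ?_⟩
  · have : ∑ k, (u s k - c s * ρ k) * (u t k - c t * ρ k) = ∑ k, u s k * u t k
        - c t * ∑ k, u s k * ρ k - c s * ∑ k, u t k * ρ k + c s * c t * ∑ k, ρ k * ρ k := by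
      simp only [Finset.mul_sum, ← Finset.sum_sub_distrib, ← Finset.sum_add_distrib]
      exact Finset.sum_congr rfl fun k _ => by ring
    rw [this, hD.gram s hs t ht, huρ s hs, huρ t ht, hρρ]; ring
  · have key : ∀ z ∈ Submodule.span ℤ (u '' (T : Set V)),
        ∃ z' ∈ Submodule.span ℤ ((fun t k => u t k - c t * ρ k) '' (T : Set V)),
          ∀ k, 2 * z' k = 2 * z k - (∑ k, z k * ρ k) * ρ k := by
      intro z hz
      induction hz using Submodule.span_induction with
      | mem z hz =>
        obtain ⟨t, ht, rfl⟩ := hz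
        refine ⟨_, Submodule.subset_span ⟨t, ht, rfl⟩, fun k => ?_⟩
        rw [huρ t ht]; ring
      | zero => exact ⟨0, zero_mem _, by simp⟩
      | add z w _ _ hz hw =>
        obtain ⟨x, hx, hx'⟩ := hz
        obtain ⟨y, hy, hy'⟩ := hw
        refine ⟨x + y, add_mem hx hy, fun k => ?_⟩
        simp only [Pi.add_apply, add_mul, Finset.sum_add_distrib, mul_add, hx', hy']
        ring
      | smul d z _ hz =>
        obtain ⟨x, hx, hx'⟩ := hz
        refine ⟨d • x, Submodule.smul_mem _ _ hx, fun k => ?_⟩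
        simp only [Pi.smul_apply, smul_eq_mul, mul_assoc, ← Finset.mul_sum]
        have := hx' k
        linear_combination d * this
    have hsum : ∀ w : ι → ℤ, Even (∑ k, w k) → Even (∑ k, w k * ρ k) := by
      intro w hw
      have h2 : Even (∑ k, (w k * ρ k - w k)) := Finset.even_sum _ fun k _ => by
        rcases hρ1 k with h | h
        · simp [h]
        · rw [h]; exact ⟨-w k, by ring⟩
      rw [Finset.sum_sub_distrib] at h2
      have := h2.add hw
      simpa using this
    obtain ⟨τ, hτ⟩ := hsum v hv
    have hρsum : Even (∑ k, ρ k) := by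
      have h2 : Even (∑ k, (ρ k - 1)) := Finset.even_sum _ fun k _ => (hρodd k).sub_odd odd_one
      rw [Finset.sum_sub_distrib] at h2
      have h3 : Even (∑ _k : ι, (1 : ℤ)) := by simp [h4]; decide
      simpa using h2.add h3
    obtain ⟨z', hz', hz''⟩ := key (fun k => v k - τ * ρ k) (hD.span _ (by
      rw [Finset.sum_sub_distrib, ← Finset.mul_sum]
      exact hv.sub (hρsum.mul_left _)))
    have : v = z' := by
      ext k
      have h5 := hz'' k
      have h6 : ∑ k, (v k - τ * ρ k) * ρ k = -(2 * τ) := by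
        simp only [sub_mul, Finset.sum_sub_distrib, mul_assoc, ← Finset.mul_sum, hτ, hρρ]
        ring
      rw [h6] at h5
      linarith
    rw [this]; exact hz'
  · have h1 : ∀ w : ι → ℤ, ∑ k, (Pi.single i η : ι → ℤ) k * w k = η * w i := fun w => by
      simp [Pi.single_apply]
    rw [h1]
    change η * (u t i - c t * ρ i) = G a t
    have h2 : c t = G a t - η * u t i := rfl
    rw [hρi]
    linear_combination c t * hηη + h2

end GrowthD

section TypeE

/-- The Cartan matrix of type `E`: a path `1, 2, 3, …` with the node `0` attached to `3`. -/
def cartanE (i j : ℕ) : ℤ :=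
  if i = j then 2
  else if (i = 0 ∧ j = 3) ∨ (i = 3 ∧ j = 0) then -1
  else if (1 ≤ i ∧ j = i + 1) ∨ (1 ≤ j ∧ i = j + 1) then -1
  else 0

variable {V : Type} [Fintype V] [DecidableEq V]

/-- The Gram matrix on `T` contains a basis `b` of the root lattice `E k`. -/
structure ERep (G : V → V → ℤ) (T : Finset V) (b : ℕ → V → ℝ) (k : ℕ) : Prop where
  card : T.card = k
  six_le : 6 ≤ k
  le_eight : k ≤ 8
  supp : ∀ i < k, ∀ v, v ∉ T → b i v = 0
  int : ∀ i < k, ∀ a, ∃ z : ℤ, bil G (stdVec a) (b i) = z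
  gram : ∀ i < k, ∀ j < k, bil G (b i) (b j) = cartanE i j
  nondeg : ∀ a, (∀ i < k, bil G (stdVec a) (b i) = 0) → ∀ t ∈ T, G a t = 0

lemma cartanE_comm (i j : ℕ) : cartanE i j = cartanE j i := by
  unfold cartanE
  split_ifs <;> first | rfl | omega

lemma bil_stdVec_int (G : V → V → ℤ) (a : V) (x : V → ℤ) :
    ∃ z : ℤ, bil G (stdVec a) (fun i => (x i : ℝ)) = z :=
  ⟨∑ j, G a j * x j, by rw [bil_stdVec]; push_cast; rfl⟩

variable {ι : Type} [Fintype ι] {G : V → V → ℤ} {T : Finset V} {u : V → ι → ℤ}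

lemma exists_ERep_of_family (h : Critical G) {a c : V} (ha : a ∉ T) (hc : c ∉ T) (hac : a ≠ c)
    (hu : ∀ s ∈ T, ∀ t ∈ T, ∑ k, u s k * u t k = G s t) {γ : ι → ℝ}
    (hγ : ∀ t ∈ T, ∑ k, γ k * (u t k : ℝ) = G a t) {k q : ℕ} (hq : q < k)
    (hk6 : 6 ≤ k) (hk8 : k ≤ 8) (hcard : T.card + 1 = k) {σ : ℤ} (hσ : σ = 1 ∨ σ = -1)
    {z : ℕ → ι → ℤ} (hz : ∀ i < k, i ≠ q → z i ∈ Submodule.span ℤ (u '' (T : Set V)))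
    (hzz : ∀ i < k, i ≠ q → ∀ j < k, j ≠ q → ∑ l, z i l * z j l = cartanE i j)
    (hγz : ∀ i < k, i ≠ q → ∑ l, γ l * (z i l : ℝ) = -σ * cartanE q i)
    (hnd : ∀ α : ι → ℝ, (∀ i < k, i ≠ q → ∑ l, α l * (z i l : ℝ) = 0) →
      ∀ t ∈ T, ∑ l, α l * (u t l : ℝ) = 0) :
    ∃ b, ERep G (insert a T) b k := by
  have hlift : ∀ i, ∃ x : V → ℤ, i < k → i ≠ q → (∀ v, v ∉ T → x v = 0) ∧
      ∀ l, ∑ v, x v * u v l = z i l := by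
    intro i
    by_cases hi : i < k ∧ i ≠ q
    · obtain ⟨x, hx⟩ := exists_coeff_of_mem_span (hz i hi.1 hi.2)
      exact ⟨x, fun _ _ => hx⟩
    · exact ⟨0, fun h1 h2 => (hi ⟨h1, h2⟩).elim⟩
  choose x hx using hlift
  have hsupp : ∀ i < k, i ≠ q → ∀ v, v ∉ T → (x i v : ℝ) = 0 := fun i hi hiq v hv => by
    simp [(hx i hi hiq).1 v hv]
  have hev : ∀ i < k, i ≠ q → ∀ l, ev u (fun v => (x i v : ℝ)) l = z i l :=
    fun i hi hiq l => by rw [← (hx i hi hiq).2 l]; simp [ev]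
  have hσσ : (σ : ℝ) * σ = 1 := by rcases hσ with rfl | rfl <;> simp
  let b : ℕ → V → ℝ := fun i => if i = q then (-σ : ℝ) • stdVec a else fun v => (x i v : ℝ)
  have hbq : b q = (-σ : ℝ) • stdVec a := by simp [b]
  have hbi : ∀ i, i ≠ q → b i = fun v => (x i v : ℝ) := fun i hi => by simp [b, hi]
  have hqi : ∀ i < k, i ≠ q → bil G (b q) (b i) = cartanE q i := by
    intro i hi hiq
    rw [hbq, hbi i hiq, map_smul, LinearMap.smul_apply, bil_stdVec_eq hγ (hsupp i hi hiq)]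
    simp only [hev i hi hiq, hγz i hi hiq, smul_eq_mul]
    linear_combination (cartanE q i : ℝ) * hσσ
  refine ⟨b, ?_, hk6, hk8, ?_, ?_, ?_, ?_⟩
  · rw [Finset.card_insert_of_notMem ha, hcard]
  · intro i hi v hv
    rw [Finset.mem_insert, not_or] at hv
    by_cases hiq : i = q
    · rw [hiq, hbq]; simp [stdVec, hv.1]
    · rw [hbi i hiq]; exact hsupp i hi hiq v hv.2
  · intro i hi c
    by_cases hiq : i = q
    · refine ⟨-σ * G c a, ?_⟩
      rw [hiq, hbq, map_smul, bil_stdVec_stdVec]; simp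
    · rw [hbi i hiq]; exact bil_stdVec_int _ _ _
  · intro i hi j hj
    by_cases hiq : i = q <;> by_cases hjq : j = q
    · rw [hiq, hjq, hbq, map_smul, map_smul, LinearMap.smul_apply, bil_stdVec_stdVec, h.diag]
      simp only [smul_eq_mul, cartanE, if_true]
      push_cast
      linear_combination 2 * hσσ
    · rw [hiq]; exact hqi j hj hjq
    · rw [hjq, bil_comm h.symm, hqi i hi hiq, cartanE_comm]
    · rw [hbi i hiq, hbi j hjq, bil_eq_of_gram hu (hsupp i hi hiq) (hsupp j hj hjq)]
      simp only [hev i hi hiq, hev j hj hjq]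
      rw [← hzz i hi hiq j hj hjq]; push_cast; rfl
  · intro d hd t ht
    rcases Finset.mem_insert.mp ht with rfl | ht
    · have := hd q hq
      rw [hbq, map_smul, bil_stdVec_stdVec, smul_eq_mul] at this
      rcases hσ with rfl | rfl <;> simpa using this
    · obtain ⟨α, hα⟩ := exists_functional (ev_injective h hac ha hc hu) (fun t => (G d t : ℝ))
      have h1 := hnd α (fun i hi hiq => by
        have h2 := hd i hi
        rw [hbi i hiq, bil_stdVec_eq hα (hsupp i hi hiq)] at h2
        simpa only [hev i hi hiq] using h2) t ht
      rw [hα t ht] at h1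
      exact_mod_cast h1

/-- Coordinates of the simple roots of type `A`. -/
def rootA (i j : ℕ) : ℤ := if j + 1 = i then 1 else if j = i then -1 else 0

/-- Coordinates of the simple roots of a subsystem of type `D` in type `E`. -/
def rootD (i j : ℕ) : ℤ :=
  if i = 0 then (if j = 0 then 1 else if j = 1 then -1 else 0)
  else if i = 2 then (if j ≤ 1 then 1 else 0)
  else if i = 3 then (if j = 0 then -1 else if j = 2 then 1 else 0)
  else (if j + 2 = i then -1 else if j + 1 = i then 1 else 0)

lemma ARep.exists_ERep [DecidableEq ι] (h : Critical G) (hA : ARep G T u) {a c : V} (ha : a ∉ T)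
    (hc : c ∉ T) (hac : a ≠ c) {σ : ℤ} {K : Finset ι} (hσ : σ = 1 ∨ σ = -1) (hK : K.card = 3)
    (h6 : 6 ≤ Fintype.card ι) (h8 : Fintype.card ι ≤ 8)
    (hγ : ∀ t ∈ T, ∑ k, (if k ∈ K then σ else 0) * u t k = G a t) :
    ∃ b, ERep G (insert a T) b (Fintype.card ι) := by
  obtain ⟨m, hm⟩ : ∃ m, m = Fintype.card ι := ⟨_, rfl⟩
  have hcard := hA.card
  rw [← hm] at h6 h8 hcard ⊢
  obtain ⟨f, hf⟩ : ∃ f : Fin m ≃ ι, ∀ i, f i ∈ K ↔ (i : ℕ) < 3 := by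
    let e0 : Fin m ≃ ι := Fintype.equivOfCardEq (by simp [hm])
    obtain ⟨τ, hτ⟩ := Equiv.Perm.exists_map_finset_eq
      ((Finset.univ.filter fun i : Fin m => (i : ℕ) < 3).map e0.toEmbedding) K (by
        rw [Finset.card_map, hK]
        interval_cases m <;> decide)
    refine ⟨e0.trans τ, fun i => ?_⟩
    rw [← hτ]
    simp
  have hsum : ∀ g : Fin m → ℤ, ∑ k, g (f.symm k) = ∑ j, g j := fun g => Equiv.sum_comp f.symm g
  have hdot : ∀ (α : ι → ℝ) (g : Fin m → ℤ), ∑ k, α k * (g (f.symm k) : ℝ)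
      = ∑ j, α (f j) * (g j : ℝ) := fun α g => by
    rw [← Equiv.sum_comp f]; simp
  have hmem : ∀ k, k ∈ K ↔ ((f.symm k : Fin m) : ℕ) < 3 := fun k => by rw [← hf]; simp
  refine exists_ERep_of_family h ha hc hac hA.gram (cast_functional hγ)
    (k := m) (q := 0) (by omega) h6 h8 hcard.symm hσ
    (z := fun i k => rootA i (f.symm k)) ?_ ?_ ?_ ?_
  · intro i hi hi0
    refine hA.span _ ?_
    rw [hsum fun j => rootA i j]
    interval_cases m <;> interval_cases i <;> first | omega | decide
  · intro i hi hi0 j hj hj0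
    rw [hsum fun l => rootA i l * rootA j l]
    revert i j
    interval_cases m <;> decide
  · intro i hi hi0
    rw [hdot _ fun j => rootA i j]
    have h1 : ∑ j : Fin m, (if (j : ℕ) < 3 then 1 else 0) * rootA i j = - cartanE 0 i := by
      revert i
      interval_cases m <;> decide
    have h2 : ∑ j : Fin m, ((if (j : ℕ) < 3 then 1 else 0 : ℤ) : ℝ) * rootA i j
        = - cartanE 0 i := by exact_mod_cast h1
    simp only [hf]
    rw [neg_mul, ← mul_neg, ← h2, Finset.mul_sum]
    refine Finset.sum_congr rfl fun j _ => ?_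
    split_ifs <;> simp
  · intro α hα t ht
    have h1 : ∀ j : Fin m, α (f j) = α (f ⟨0, by omega⟩) := by
      have h3 : ∀ i < m, i ≠ 0 → ∑ j : Fin m, α (f j) * (rootA i j : ℝ) = 0 := fun i hi hi0 => by
        rw [← hdot _ fun j => rootA i j]; exact hα i hi hi0
      have h4 : ∀ i (hi : i + 1 < m), α (f ⟨i + 1, hi⟩) = α (f ⟨i, by omega⟩) := by
        intro i hi
        have h5 := h3 (i + 1) hi (by omega)
        have h6 : ∀ j : Fin m, α (f j) * (rootA (i + 1) j : ℝ)
            = (if j = ⟨i, by omega⟩ then α (f j) else 0)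
              - (if j = ⟨i + 1, hi⟩ then α (f j) else 0) := by
          intro j
          simp only [rootA, Fin.ext_iff]
          split_ifs <;> first | omega | simp
        simp only [h6, Finset.sum_sub_distrib, Finset.sum_ite_eq', Finset.mem_univ, if_true] at h5
        linarith
      rintro ⟨j, hj⟩
      induction j with
      | zero => rfl
      | succ j ih => rw [h4 j hj, ih]
    have h2 : ∀ k, α k = α (f ⟨0, by omega⟩) := fun k => by
      rw [← h1 (f.symm k)]; simp
    rw [Finset.sum_congr rfl fun k _ => by rw [h2 k], ← Finset.mul_sum]
    have : ∑ k, (u t k : ℝ) = 0 := by exact_mod_cast hA.sum_zero t ht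
    rw [this, mul_zero]

lemma eq_zero_of_rootD {m : ℕ} (h5 : 5 ≤ m) (h7 : m ≤ 7) {β : Fin m → ℝ}
    (h : ∀ i < m + 1, i ≠ 1 → ∑ j : Fin m, β j * (rootD i j : ℝ) = 0) (j : Fin m) : β j = 0 := by
  have h0 := h 0 (by omega) (by omega)
  have h2 := h 2 (by omega) (by omega)
  have h3 := h 3 (by omega) (by omega)
  have hi := fun i (h4 : 4 ≤ i) (hi : i < m + 1) => h i hi (by omega)
  clear h
  interval_cases m
  · have e4 := hi 4 (by omega) (by omega)
    have e5 := hi 5 (by omega) (by omega)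
    simp only [Fin.sum_univ_five] at h0 h2 h3 e4 e5
    norm_num [rootD] at h0 h2 h3 e4 e5
    fin_cases j <;> simp <;> linarith
  · have e4 := hi 4 (by omega) (by omega)
    have e5 := hi 5 (by omega) (by omega)
    have e6 := hi 6 (by omega) (by omega)
    simp only [Fin.sum_univ_six] at h0 h2 h3 e4 e5 e6
    norm_num [rootD] at h0 h2 h3 e4 e5 e6
    fin_cases j <;> simp <;> linarith
  · have e4 := hi 4 (by omega) (by omega)
    have e5 := hi 5 (by omega) (by omega)
    have e6 := hi 6 (by omega) (by omega)
    have e7 := hi 7 (by omega) (by omega)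
    simp only [Fin.sum_univ_seven] at h0 h2 h3 e4 e5 e6 e7
    norm_num [rootD] at h0 h2 h3 e4 e5 e6 e7
    fin_cases j <;> simp <;> linarith

lemma DRep.exists_ERep [DecidableEq ι] (h : Critical G) (hD : DRep G T u) {a c : V} (ha : a ∉ T)
    (hc : c ∉ T) (hac : a ≠ c) {ε : ι → ℤ} (hε : ∀ k, ε k = 1 ∨ ε k = -1)
    (h5 : 5 ≤ Fintype.card ι) (h7 : Fintype.card ι ≤ 7)
    (hγ : ∀ t ∈ T, ∑ k, ε k * u t k = 2 * G a t) :
    ∃ b, ERep G (insert a T) b (Fintype.card ι + 1) := by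
  obtain ⟨m, hm⟩ : ∃ m, m = Fintype.card ι := ⟨_, rfl⟩
  have hcard := hD.card
  rw [← hm] at h5 h7 hcard ⊢
  let f : Fin m ≃ ι := Fintype.equivOfCardEq (by simp [hm])
  have hsum : ∀ g : Fin m → ℤ, ∑ k, g (f.symm k) = ∑ j, g j := fun g => Equiv.sum_comp f.symm g
  have hdot : ∀ (α : ι → ℝ) (g : Fin m → ℤ), ∑ k, α k * (g (f.symm k) : ℝ)
      = ∑ j, α (f j) * (g j : ℝ) := fun α g => by
    rw [← Equiv.sum_comp f]; simp
  have hεε : ∀ k, ε k * ε k = 1 := fun k => by rcases hε k with h | h <;> simp [h]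
  refine exists_ERep_of_family h ha hc hac hD.gram (γ := fun k => (ε k : ℝ) / 2) ?_
    (k := m + 1) (q := 1) (σ := 1) (by omega) (by omega) (by omega) (by omega) (by simp)
    (z := fun i k => ε k * rootD i (f.symm k)) ?_ ?_ ?_ ?_
  · intro t ht
    have h1 : ∑ k, (ε k : ℝ) * (u t k : ℝ) = 2 * (G a t : ℝ) := by exact_mod_cast hγ t ht
    have h2 : ∑ k, (ε k : ℝ) / 2 * (u t k : ℝ) = (∑ k, (ε k : ℝ) * (u t k : ℝ)) / 2 := by
      rw [Finset.sum_div]; exact Finset.sum_congr rfl fun k _ => by ring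
    rw [h2, h1]; ring
  · intro i hi hi0
    refine hD.span _ ?_
    have h1 : Even (∑ k, (ε k * rootD i (f.symm k) - rootD i (f.symm k))) :=
      Finset.even_sum _ fun k _ => by
        rcases hε k with h | h
        · simp [h]
        · rw [h]; exact ⟨-rootD i (f.symm k), by ring⟩
    have h2 : Even (∑ k, rootD i (f.symm k)) := by
      rw [hsum fun j => rootD i j]
      clear h1
      revert i
      interval_cases m <;> decide
    rw [Finset.sum_sub_distrib] at h1
    simpa using h1.add h2
  · intro i hi hi0 j hj hj0
    have h1 : ∀ k, ε k * rootD i (f.symm k) * (ε k * rootD j (f.symm k))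
        = rootD i (f.symm k) * rootD j (f.symm k) := fun k => by
      linear_combination rootD i (f.symm k) * rootD j (f.symm k) * hεε k
    simp only [h1]
    rw [hsum fun l => rootD i l * rootD j l]
    clear h1
    revert i j
    interval_cases m <;> decide
  · intro i hi hi0
    have h1 : ∑ k, rootD i (f.symm k) = - (2 * cartanE 1 i) := by
      rw [hsum fun j => rootD i j]
      revert i
      interval_cases m <;> decide
    have h2 : ∑ k, (rootD i (f.symm k) : ℝ) = - (2 * cartanE 1 i) := by exact_mod_cast h1
    have h3 : ∀ k, (ε k : ℝ) / 2 * ((ε k * rootD i (f.symm k) : ℤ) : ℝ)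
        = (rootD i (f.symm k) : ℝ) / 2 := fun k => by
      have : (ε k : ℝ) * ε k = 1 := by exact_mod_cast hεε k
      push_cast
      linear_combination (rootD i (f.symm k) : ℝ) / 2 * this
    simp only [h3]
    rw [← Finset.sum_div, h2]; push_cast; ring
  · intro α hα t ht
    have h3 : ∀ i < m + 1, i ≠ 1 → ∑ j : Fin m, (α (f j) * ε (f j)) * (rootD i j : ℝ) = 0 := by
      intro i hi hi0
      rw [← hdot (fun k => α k * ε k) fun j => rootD i j, ← hα i hi hi0]
      exact Finset.sum_congr rfl fun k _ => by push_cast; ring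
    have h1 : ∀ j : Fin m, α (f j) * ε (f j) = 0 :=
      eq_zero_of_rootD h5 h7 h3
    have h2 : ∀ k, α k = 0 := fun k => by
      have h4 := h1 (f.symm k)
      simp only [Equiv.apply_symm_apply] at h4
      rcases mul_eq_zero.mp h4 with h | h
      · exact h
      · rcases hε k with h' | h' <;> simp [h'] at h
    simp [h2]

end TypeE

section GrowthE

variable {V : Type} [Fintype V] [DecidableEq V]
variable {G : V → V → ℤ} {T : Finset V} {b : ℕ → V → ℝ} {k : ℕ}

/-- Integer combination of the first `k` vectors of a family. -/
noncomputable def comb (b : ℕ → V → ℝ) (k : ℕ) (x : ℕ → ℤ) : V → ℝ :=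
  ∑ i ∈ Finset.range k, (x i : ℝ) • b i

omit [Fintype V] [DecidableEq V] in
lemma comb_add (x y : ℕ → ℤ) : comb b k (x + y) = comb b k x + comb b k y := by
  simp [comb, add_smul, Finset.sum_add_distrib]

omit [Fintype V] [DecidableEq V] in
lemma comb_single {j : ℕ} (hj : j < k) (n : ℤ) : comb b k (Pi.single j n) = (n : ℝ) • b j := by
  rw [comb, Finset.sum_eq_single j]
  · simp
  · intro i _ hij; simp [hij]
  · simp [hj]

lemma bil_comb (y : V → ℝ) (x : ℕ → ℤ) :
    bil G y (comb b k x) = ∑ i ∈ Finset.range k, (x i : ℝ) * bil G y (b i) := by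
  simp [comb, map_sum]

namespace ERep

lemma comb_supp (hE : ERep G T b k) (x : ℕ → ℤ) {v : V} (hv : v ∉ T) : comb b k x v = 0 := by
  rw [comb, Finset.sum_apply]
  refine Finset.sum_eq_zero fun i hi => ?_
  simp [hE.supp i (Finset.mem_range.mp hi) v hv]

lemma bil_comb_basis (h : Critical G) (hE : ERep G T b k) (x : ℕ → ℤ) {j : ℕ} (hj : j < k) :
    bil G (comb b k x) (b j) = (∑ i ∈ Finset.range k, x i * cartanE i j : ℤ) := by
  rw [bil_comm h.symm, bil_comb]
  push_cast
  refine Finset.sum_congr rfl fun i hi => ?_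
  rw [bil_comm h.symm, hE.gram i (Finset.mem_range.mp hi) j hj]

lemma bil_comb_comb (h : Critical G) (hE : ERep G T b k) (x : ℕ → ℤ) :
    bil G (comb b k x) (comb b k x)
      = (∑ j ∈ Finset.range k, x j * ∑ i ∈ Finset.range k, x i * cartanE i j : ℤ) := by
  rw [bil_comb]
  push_cast
  refine Finset.sum_congr rfl fun j hj => ?_
  rw [bil_comb_basis h hE x (Finset.mem_range.mp hj)]; push_cast; rfl

/-- Twice the coefficients of the Weyl vector. -/
def weylCoeff (k j : ℕ) : ℤ :=
  if k = 6 then [22, 16, 30, 42, 30, 16].getD j 0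
  else if k = 7 then [49, 34, 66, 96, 75, 52, 27].getD j 0
  else [136, 92, 182, 270, 220, 168, 114, 58].getD j 0

lemma sum_weylCoeff {k j : ℕ} (h6 : 6 ≤ k) (h8 : k ≤ 8) (hj : j < k) :
    ∑ i ∈ Finset.range k, weylCoeff k i * cartanE i j = 2 := by
  revert j
  interval_cases k <;> decide

lemma pos_of_apply_ne (h : Critical G) {a c d : V} (hc : c ∉ T)
    (hd : d ∉ T) (hac : a ≠ c) (had : a ≠ d) (hcd : c ≠ d) {y : V → ℝ}
    (hy : ∀ v, v ∉ insert a T → y v = 0) (hne : y ≠ 0) : 0 < bil G y y :=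
  h.pos hcd (hy c (by simp [hac.symm, hc])) (hy d (by simp [had.symm, hd])) hne

/-- Among the norm `2` translates of an extra vector by the root lattice there is one having
products `0` or `-1` with all simple roots. -/
lemma exists_minimal (h : Critical G) (hE : ERep G T b k) {a c d : V} (ha : a ∉ T) (hc : c ∉ T)
    (hd : d ∉ T) (hac : a ≠ c) (had : a ≠ d) (hcd : c ≠ d) (hadj : ∃ t ∈ T, G a t ≠ 0) :
    ∃ (x p : ℕ → ℤ), bil G (stdVec a + comb b k x) (stdVec a + comb b k x) = 2 ∧
      (∀ j < k, bil G (stdVec a + comb b k x) (b j) = -(p j : ℝ)) ∧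
      (∀ j < k, p j = 0 ∨ p j = 1) ∧ ∃ j < k, p j = 1 := by
  have hsupp : ∀ x : ℕ → ℤ, ∀ v, v ∉ insert a T → (stdVec a + comb b k x) v = 0 := by
    intro x v hv
    rw [Finset.mem_insert, not_or] at hv
    simp [stdVec, hv.1, hE.comb_supp x hv.2]
  have hval : ∀ x : ℕ → ℤ, (stdVec a + comb b k x) a = 1 := by
    intro x; simp [stdVec, hE.comb_supp x ha]
  choose! e he using fun i hi => hE.int i hi a
  have hprod : ∀ x : ℕ → ℤ, ∀ j < k, bil G (stdVec a + comb b k x) (b j)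
      = (e j + ∑ i ∈ Finset.range k, x i * cartanE i j : ℤ) := by
    intro x j hj
    rw [map_add, LinearMap.add_apply, he j hj, bil_comb_basis h hE x hj]; push_cast; rfl
  let P : ℤ → Prop := fun s => ∃ x : ℕ → ℤ,
    bil G (stdVec a + comb b k x) (stdVec a + comb b k x) = 2 ∧ s = ∑ i ∈ Finset.range k, x i
  have hbdd : ∃ B : ℤ, ∀ s, P s → B ≤ s := by
    set w := weylCoeff k with hw
    set H := bil G (comb b k w) (comb b k w)
    set E0 := bil G (stdVec a) (comb b k w)
    refine ⟨⌊(-(2 + H + 2 * E0) / 4)⌋, ?_⟩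
    rintro s ⟨x, hx, rfl⟩
    have h1 := h.nonneg (stdVec a + comb b k x + (1 : ℝ) • comb b k w) ⟨c, by
      simp [stdVec, hac.symm, hE.comb_supp _ hc]⟩
    have h2 : bil G (comb b k x) (comb b k w) = 2 * ∑ i ∈ Finset.range k, (x i : ℝ) := by
      rw [bil_comm h.symm, bil_comb, Finset.mul_sum]
      refine Finset.sum_congr rfl fun i hi => ?_
      rw [bil_comb_basis h hE w (Finset.mem_range.mp hi),
        sum_weylCoeff hE.six_le hE.le_eight (Finset.mem_range.mp hi)]
      push_cast; ring
    rw [bil_add_smul h.symm, hx, map_add, LinearMap.add_apply, h2] at h1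
    have h3 : -(2 + H + 2 * E0) / 4 ≤ ((∑ i ∈ Finset.range k, x i : ℤ) : ℝ) := by
      push_cast; linarith
    have h4 := Int.floor_le_floor h3
    rwa [Int.floor_intCast] at h4
  obtain ⟨s, ⟨x, hx, rfl⟩, hmin⟩ := Int.exists_least_of_bdd hbdd
    ⟨0, 0, by simp [comb, bil_stdVec_stdVec, h.diag], by simp⟩
  set v := stdVec a + comb b k x with hv
  have hv0 : ∀ n : ℝ, ∀ j < k, v + n • b j ≠ 0 := by
    intro n j hj h0
    have h1 := congrFun h0 a
    rw [Pi.add_apply, hv, hval] at h1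
    simp [hE.supp j hj a ha] at h1
  have hpos : ∀ n : ℝ, ∀ j < k, 0 < bil G (v + n • b j) (v + n • b j) := by
    intro n j hj
    refine pos_of_apply_ne h hc hd hac had hcd (fun w hw => ?_) (hv0 n j hj)
    rw [Pi.add_apply, hv, hsupp x w hw]
    simp [hE.supp j hj w (fun hwT => hw (Finset.mem_insert_of_mem hwT))]
  set p : ℕ → ℤ := fun j => -(e j + ∑ i ∈ Finset.range k, x i * cartanE i j) with hp
  have hvp : ∀ j < k, bil G v (b j) = -(p j : ℝ) := by
    intro j hj
    rw [hv, hprod x j hj, hp]; push_cast; ring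
  have hbb : ∀ j < k, bil G (b j) (b j) = 2 := by
    intro j hj; rw [hE.gram j hj j hj]; simp [cartanE]
  have hp01 : ∀ j < k, p j = 0 ∨ p j = 1 := by
    intro j hj
    have h1 := hpos 1 j hj
    have h2 := hpos (-1) j hj
    rw [bil_add_smul h.symm, hx, hvp j hj, hbb j hj] at h1 h2
    have h3 : (p j : ℝ) < 2 := by linarith
    have h4 : (-2 : ℝ) < p j := by linarith
    have h3' : p j < 2 := by exact_mod_cast h3
    have h4' : -2 < p j := by exact_mod_cast h4
    have h5 : p j ≠ -1 := by
      intro h5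
      have h6 : stdVec a + comb b k (x + Pi.single j (-1)) = v + (-1 : ℝ) • b j := by
        rw [comb_add, comb_single hj, hv, add_assoc]; simp
      have h7 := hmin (∑ i ∈ Finset.range k, (x + Pi.single j (-1) : ℕ → ℤ) i)
        ⟨x + Pi.single j (-1), by
          rw [h6, bil_add_smul h.symm, hx, hvp j hj, hbb j hj, h5]; norm_num, rfl⟩
      have h8 : ∑ i ∈ Finset.range k, (Pi.single j (-1) : ℕ → ℤ) i = -1 := by
        rw [Finset.sum_eq_single j (fun i _ hij => by simp [hij]) (by simp [hj])]; simp
      simp only [Pi.add_apply, Finset.sum_add_distrib, h8] at h7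
      omega
    omega
  refine ⟨x, p, hx, hvp, hp01, ?_⟩
  by_contra hcon
  push Not at hcon
  have hp0 : ∀ j < k, p j = 0 := fun j hj => (hp01 j hj).resolve_right (hcon j hj)
  have h1 : bil G v (comb b k x) = 0 := by
    rw [bil_comb]
    refine Finset.sum_eq_zero fun i hi => ?_
    rw [hvp i (Finset.mem_range.mp hi), hp0 i (Finset.mem_range.mp hi)]; simp
  have h2 : stdVec a = v + (-1 : ℝ) • comb b k x := by rw [hv]; simp
  have h3 : bil G (stdVec a) (stdVec a) = 2 := by rw [bil_stdVec_stdVec, h.diag]; simp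
  rw [h2, bil_add_smul h.symm, hx, h1] at h3
  have h4 : comb b k x = 0 := by
    by_contra hne
    have := pos_of_apply_ne (T := T) h hc hd hac had hcd (fun w hw =>
      hE.comb_supp x (fun hwT => hw (Finset.mem_insert_of_mem hwT))) hne
    linarith
  obtain ⟨t, ht, hGt⟩ := hadj
  refine hGt (hE.nondeg a (fun i hi => ?_) t ht)
  rw [h2, h4, smul_zero, add_zero, hvp i hi, hp0 i hi]; simp

/-- A nonnegative combination with small marks cannot be subtracted from a vector of norm `2`. -/
lemma exclusion (h : Critical G) (hE : ERep G T b k) {a c d : V} (ha : a ∉ T) (hc : c ∉ T)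
    (hd : d ∉ T) (hac : a ≠ c) (had : a ≠ d) (hcd : c ≠ d) {x p : ℕ → ℤ}
    (hv : bil G (stdVec a + comb b k x) (stdVec a + comb b k x) = 2)
    (hp : ∀ j < k, bil G (stdVec a + comb b k x) (b j) = -(p j : ℝ)) {D : ℤ} (hD : 0 < D)
    {W τ : ℕ → ℤ} (hW : ∀ j < k, 0 ≤ W j)
    (hτ : ∀ j < k, ∑ i ∈ Finset.range k, W i * cartanE i j = τ j)
    (hle : ∀ j < k, τ j ≤ D * p j)
    (h2 : 2 * D ^ 2 ≤ ∑ j ∈ Finset.range k, W j * τ j) : False := by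
  set v := stdVec a + comb b k x with hvdef
  have hva : v a = 1 := by simp [hvdef, stdVec, hE.comb_supp x ha]
  have h1 : 0 < bil G ((D : ℝ) • v + (1 : ℝ) • comb b k W) ((D : ℝ) • v + (1 : ℝ) • comb b k W) := by
    refine pos_of_apply_ne (T := T) (a := a) h hc hd hac had hcd (fun w hw => ?_) fun h0 => ?_
    · rw [Finset.mem_insert, not_or] at hw
      simp [hvdef, stdVec, hw.1, hE.comb_supp _ hw.2]
    · have h3 := congrFun h0 a
      simp [hva, hE.comb_supp _ ha] at h3
      exact hD.ne' h3
  have h3 : bil G v (comb b k W) = -(∑ j ∈ Finset.range k, W j * p j : ℤ) := by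
    rw [bil_comb]; push_cast
    rw [← Finset.sum_neg_distrib]
    refine Finset.sum_congr rfl fun j hj => ?_
    rw [hp j (Finset.mem_range.mp hj)]; ring
  have h4 : bil G (comb b k W) (comb b k W) = (∑ j ∈ Finset.range k, W j * τ j : ℤ) := by
    rw [hE.bil_comb_comb h]
    congr 1
    exact Finset.sum_congr rfl fun j hj => by rw [hτ j (Finset.mem_range.mp hj)]
  rw [bil_add_smul h.symm, map_smul, map_smul, LinearMap.smul_apply, LinearMap.smul_apply, h3,
    h4, hv] at h1
  simp only [smul_eq_mul] at h1
  have h5 : 0 < D * (D * 2) + 2 * 1 * (D * -(∑ j ∈ Finset.range k, W j * p j))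
      + 1 ^ 2 * ∑ j ∈ Finset.range k, W j * τ j := by exact_mod_cast h1
  have h6 : ∑ j ∈ Finset.range k, W j * τ j ≤ D * ∑ j ∈ Finset.range k, W j * p j := by
    rw [Finset.mul_sum]
    refine Finset.sum_le_sum fun j hj => ?_
    have := mul_le_mul_of_nonneg_left (hle j (Finset.mem_range.mp hj)) (hW j (Finset.mem_range.mp hj))
    linarith
  nlinarith

/-- Rows of the inverse Cartan matrix, multiplied by its determinant. -/
def fundWeight (k l j : ℕ) : ℤ :=
  if k = 6 then ([[6, 3, 6, 9, 6, 3], [3, 4, 5, 6, 4, 2], [6, 5, 10, 12, 8, 4],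
    [9, 6, 12, 18, 12, 6], [6, 4, 8, 12, 10, 5], [3, 2, 4, 6, 5, 4]].getD l []).getD j 0
  else if k = 7 then ([[7, 4, 8, 12, 9, 6, 3], [4, 4, 6, 8, 6, 4, 2], [8, 6, 12, 16, 12, 8, 4],
    [12, 8, 16, 24, 18, 12, 6], [9, 6, 12, 18, 15, 10, 5], [6, 4, 8, 12, 10, 8, 4],
    [3, 2, 4, 6, 5, 4, 3]].getD l []).getD j 0
  else ([[8, 5, 10, 15, 12, 9, 6, 3], [5, 4, 7, 10, 8, 6, 4, 2], [10, 7, 14, 20, 16, 12, 8, 4],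
    [15, 10, 20, 30, 24, 18, 12, 6], [12, 8, 16, 24, 20, 15, 10, 5],
    [9, 6, 12, 18, 15, 12, 8, 4], [6, 4, 8, 12, 10, 8, 6, 3],
    [3, 2, 4, 6, 5, 4, 3, 2]].getD l []).getD j 0

lemma sum_fundWeight {k l j : ℕ} (h6 : 6 ≤ k) (h8 : k ≤ 8) (hl : l < k) (hj : j < k) :
    ∑ i ∈ Finset.range k, fundWeight k l i * cartanE i j
      = if j = l then 9 - (k : ℤ) else 0 := by
  have key : ∀ l < k, ∀ j < k, ∑ i ∈ Finset.range k, fundWeight k l i * cartanE i j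
      = if j = l then 9 - (k : ℤ) else 0 := by
    clear hl hj
    interval_cases k <;> decide
  exact key l hl j hj

lemma fundWeight_nonneg {k l j : ℕ} (h6 : 6 ≤ k) (h8 : k ≤ 8) (hl : l < k) (hj : j < k) :
    0 ≤ fundWeight k l j := by
  have key : ∀ l < k, ∀ j < k, 0 ≤ fundWeight k l j := by
    clear hl hj
    interval_cases k <;> decide
  exact key l hl j hj

/-- The vector of products is a minuscule weight. -/
lemma minimal_weight (h : Critical G) (hE : ERep G T b k) {a c d : V} (ha : a ∉ T) (hc : c ∉ T)
    (hd : d ∉ T) (hac : a ≠ c) (had : a ≠ d) (hcd : c ≠ d) {x p : ℕ → ℤ}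
    (hv : bil G (stdVec a + comb b k x) (stdVec a + comb b k x) = 2)
    (hp : ∀ j < k, bil G (stdVec a + comb b k x) (b j) = -(p j : ℝ))
    (hp01 : ∀ j < k, p j = 0 ∨ p j = 1) (hp1 : ∃ j < k, p j = 1) :
    k ≤ 7 ∧ ((∀ j < k, p j = if j = k - 1 then 1 else 0) ∨
      (k = 6 ∧ ∀ j < k, p j = if j = 1 then 1 else 0)) := by
  have hk6 := hE.six_le
  have hk8 := hE.le_eight
  have key : ∀ l < k, p l = 1 → fundWeight k l l < 2 * (9 - k) := by
    intro l hl hpl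
    by_contra hcon
    push Not at hcon
    refine hE.exclusion h ha hc hd hac had hcd hv hp (D := 9 - k) (by omega)
      (W := fundWeight k l) (τ := fun j => if j = l then 9 - (k : ℤ) else 0)
      (fun j hj => fundWeight_nonneg hk6 hk8 hl hj)
      (fun j hj => sum_fundWeight hk6 hk8 hl hj) (fun j hj => ?_) ?_
    · by_cases hjl : j = l
      · simp [hjl, hpl]
      · have : 0 ≤ p j := by rcases hp01 j hj with h | h <;> omega
        simp only [hjl, if_false]
        exact mul_nonneg (by omega) this
    · simp only [mul_ite, mul_zero, Finset.sum_ite_eq', Finset.mem_range, hl, if_true]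
      nlinarith
  have hmem : ∀ l < k, p l = 1 → (k = 7 ∧ l = 6) ∨ (k = 6 ∧ (l = 1 ∨ l = 5)) := by
    intro l hl hpl
    have h1 := key l hl hpl
    clear key
    revert h1
    clear hp1 hp01 hp hv hpl hE
    revert l
    interval_cases k <;> decide
  obtain ⟨l, hl, hpl⟩ := hp1
  have hk : k = 6 ∨ k = 7 := by rcases hmem l hl hpl with h | h <;> omega
  rcases hk with rfl | rfl
  · refine ⟨by omega, ?_⟩
    have h15 : ¬ (p 1 = 1 ∧ p 5 = 1) := by
      rintro ⟨hp1, hp5⟩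
      refine hE.exclusion h ha hc hd hac had hcd hv hp (D := 3) (by omega)
        (W := fun j => fundWeight 6 1 j + fundWeight 6 5 j)
        (τ := fun j => if j = 1 ∨ j = 5 then 3 else 0) ?_ ?_ (fun j hj => ?_) ?_
      · decide
      · decide
      · by_cases hj15 : j = 1 ∨ j = 5
        · rcases hj15 with rfl | rfl <;> simp [hp1, hp5]
        · have : 0 ≤ p j := by rcases hp01 j hj with h | h <;> omega
          simp only [hj15, if_false]; omega
      · decide
    have h0 : ∀ j < 6, j ≠ 1 → j ≠ 5 → p j = 0 := by
      intro j hj h1 h5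
      refine (hp01 j hj).resolve_right fun hpj => ?_
      rcases hmem j hj hpj with h | h <;> omega
    by_cases h5 : p 5 = 1
    · left
      intro j hj
      by_cases hj5 : j = 5
      · simp [hj5, h5]
      · by_cases hj1 : j = 1
        · subst hj1
          have := hp01 1 hj
          simp; omega
        · simp [hj5, h0 j hj hj1 hj5]
    · right
      refine ⟨rfl, fun j hj => ?_⟩
      have h50 : p 5 = 0 := (hp01 5 (by omega)).resolve_right h5
      by_cases hj1 : j = 1
      · subst hj1
        rcases hmem l hl hpl with h | ⟨_, rfl | rfl⟩
        · omega
        · simp [hpl]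
        · contradiction
      · by_cases hj5 : j = 5
        · subst hj5; simp [h50]
        · simp [hj1, h0 j hj hj1 hj5]
  · refine ⟨le_rfl, Or.inl fun j hj => ?_⟩
    by_cases hj6 : j = 6
    · subst hj6
      rcases hmem l hl hpl with ⟨_, rfl⟩ | h
      · simp [hpl]
      · omega
    · simp only [show 7 - 1 = 6 from rfl, hj6, if_false]
      refine (hp01 j hj).resolve_right fun hpj => ?_
      rcases hmem j hj hpj with h | h <;> omega

/-- The nontrivial diagram automorphism of `E₆`. -/
def flip (i : ℕ) : ℕ := if i = 0 then 0 else 6 - i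

lemma relabel (hE : ERep G T b 6) : ERep G T (fun i => b (flip i)) 6 := by
  have hlt : ∀ i < 6, flip i < 6 := by decide
  have hff : ∀ i < 6, flip (flip i) = i := by decide
  have hC : ∀ i < 6, ∀ j < 6, cartanE (flip i) (flip j) = cartanE i j := by decide
  refine ⟨hE.card, hE.six_le, hE.le_eight, fun i hi => hE.supp _ (hlt i hi),
    fun i hi => hE.int _ (hlt i hi), fun i hi j hj => ?_, fun a ha => hE.nondeg a fun i hi => ?_⟩
  · rw [hE.gram _ (hlt i hi) _ (hlt j hj), hC i hi j hj]
  · have := ha (flip i) (hlt i hi)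
    rwa [hff i hi] at this

lemma extend (h : Critical G) (hE : ERep G T b k) (hk : k ≤ 7) {a : V} (ha : a ∉ T)
    {b₀ : ℕ → V → ℝ} (hb₀ : ERep G T b₀ k) {x : ℕ → ℤ}
    (hv : bil G (stdVec a + comb b₀ k x) (stdVec a + comb b₀ k x) = 2)
    (hp : ∀ j < k, bil G (stdVec a + comb b₀ k x) (b j) = -(if j = k - 1 then 1 else 0 : ℤ)) :
    ERep G (insert a T) (Function.update b k (stdVec a + comb b₀ k x)) (k + 1) := by
  have hk6 := hE.six_le
  set v := stdVec a + comb b₀ k x with hvdef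
  have hne : ∀ i < k, Function.update b k v i = b i := fun i hi => by
    simp [hi.ne]
  have hkk : Function.update b k v k = v := by simp
  have hC : ∀ j < k, cartanE k j = -(if j = k - 1 then 1 else 0 : ℤ) := by
    interval_cases k <;> decide
  refine ⟨?_, by omega, by omega, fun i hi w hw => ?_, fun i hi c => ?_, fun i hi j hj => ?_,
    fun c hc t ht => ?_⟩
  · rw [Finset.card_insert_of_notMem ha, hE.card]
  · rw [Finset.mem_insert, not_or] at hw
    rcases Nat.lt_succ_iff_lt_or_eq.mp hi with hi | rfl
    · rw [hne i hi]; exact hE.supp i hi w hw.2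
    · rw [hkk]; simp [hvdef, stdVec, hw.1, hb₀.comb_supp x hw.2]
  · rcases Nat.lt_succ_iff_lt_or_eq.mp hi with hi | rfl
    · rw [hne i hi]; exact hE.int i hi c
    · rw [hkk, hvdef, map_add, bil_stdVec_stdVec, bil_comb]
      choose! e he using fun i hi => hb₀.int i hi c
      refine ⟨G c a + ∑ j ∈ Finset.range i, x j * e j, ?_⟩
      push_cast
      congr 1
      exact Finset.sum_congr rfl fun j hj => by rw [he j (Finset.mem_range.mp hj)]
  · rcases Nat.lt_succ_iff_lt_or_eq.mp hi with hi | rfl <;>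
      rcases Nat.lt_succ_iff_lt_or_eq.mp hj with hj | rfl
    · rw [hne i hi, hne j hj, hE.gram i hi j hj]
    · rw [hne i hi, hkk, bil_comm h.symm, hp i hi, cartanE_comm, hC i hi]; push_cast; rfl
    · rw [hne j hj, hkk, hp j hj, hC j hj]; push_cast; rfl
    · rw [hkk, hv]; simp [cartanE]
  · have hc0 : ∀ i < k, bil G (stdVec c) (b i) = 0 := fun i hi => by
      have := hc i (by omega)
      rwa [hne i hi] at this
    have hT := hE.nondeg c hc0
    rcases Finset.mem_insert.mp ht with rfl | ht
    · have h1 := hc k (by omega)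
      rw [hkk, hvdef, map_add, bil_stdVec_stdVec, bil_stdVec] at h1
      rw [Finset.sum_eq_zero] at h1
      · simpa using h1
      · intro j _
        by_cases hj : j ∈ T
        · simp [hT j hj]
        · simp [hb₀.comb_supp x hj]
    · exact hT t ht

lemma grow (h : Critical G) (hE : ERep G T b k) {a c d : V} (ha : a ∉ T) (hc : c ∉ T)
    (hd : d ∉ T) (hac : a ≠ c) (had : a ≠ d) (hcd : c ≠ d) (hadj : ∃ t ∈ T, G a t ≠ 0) :
    ∃ b', ERep G (insert a T) b' (k + 1) := by
  obtain ⟨x, p, hv, hp, hp01, hp1⟩ := hE.exists_minimal h ha hc hd hac had hcd hadj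
  obtain ⟨hk, hw | ⟨rfl, hw⟩⟩ := hE.minimal_weight h ha hc hd hac had hcd hv hp hp01 hp1
  · exact ⟨_, hE.extend h hk ha hE hv fun j hj => by rw [hp j hj, hw j hj]⟩
  · refine ⟨_, hE.relabel.extend h hk ha hE hv fun j hj => ?_⟩
    have hlt : ∀ i < 6, flip i < 6 := by decide
    rw [hp _ (hlt j hj), hw _ (hlt j hj)]
    have : ∀ j < 6, (if flip j = 1 then 1 else 0 : ℤ) = if j = 6 - 1 then 1 else 0 := by decide
    rw [this j hj]

end ERep

end GrowthE

section Growth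

variable {V : Type} [Fintype V] [DecidableEq V] {G : V → V → ℤ} {T : Finset V}

/-- The vertices in `T` span a root lattice of type `A`, `D` or `E`. -/
def IsADE (G : V → V → ℤ) (T : Finset V) : Prop :=
  (∃ (ι : Type) (_ : Fintype ι) (_ : DecidableEq ι) (u : V → ι → ℤ), ARep G T u) ∨
  (∃ (ι : Type) (_ : Fintype ι) (_ : DecidableEq ι) (u : V → ι → ℤ), DRep G T u) ∨
  ∃ b k, ERep G T b k

lemma isADE_singleton (h : Critical G) (a : V) : IsADE G {a} := by
  left
  refine ⟨Bool, inferInstance, inferInstance, fun _ k => if k then 1 else -1,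
    by simp, by simp, ?_, fun z hz => ?_⟩
  · simp [h.diag]
  · rw [Finset.coe_singleton, Set.image_singleton, Submodule.mem_span_singleton]
    rw [Fintype.sum_bool] at hz
    refine ⟨z true, ?_⟩
    ext k
    cases k
    · simp; omega
    · simp

lemma IsADE.exists_insert (h : Critical G) (hT : IsADE G T) (hne : T.Nonempty)
    (hcard : T.card + 3 ≤ Fintype.card V) : ∃ a, a ∉ T ∧ IsADE G (insert a T) := by
  have hc : 2 < Tᶜ.card := by rw [Finset.card_compl]; omega
  obtain ⟨b₀, hb₀⟩ := Finset.card_pos.mp (show 0 < Tᶜ.card by omega)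
  obtain ⟨a, ha, hadj⟩ := h.exists_adj hne (Finset.mem_compl.mp hb₀)
  refine ⟨a, ha, ?_⟩
  have h1 : 1 < (Tᶜ.erase a).card := by
    rw [Finset.card_erase_of_mem (Finset.mem_compl.mpr ha)]; omega
  obtain ⟨c, hc, d, hd, hcd⟩ := Finset.one_lt_card.mp h1
  simp only [Finset.mem_erase, Finset.mem_compl] at hc hd
  rcases hT with ⟨ι, _, _, u, hA⟩ | ⟨ι, _, _, u, hD⟩ | ⟨b, k, hE⟩
  · obtain ⟨γ, hγ, ⟨i, ε, hε, rfl⟩ | ⟨σ, hσ, hS, hN, h4⟩ | ⟨σ, K, hσ, hK, hγK, h6, h8⟩⟩ :=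
      hA.functional_cases h ha hc.2 hd.2 hc.1.symm hd.1.symm hcd hadj
    · exact Or.inl ⟨_, _, inferInstance, _, hA.extend h.symm (h.diag a) ha hε hγ⟩
    · exact Or.inr (Or.inl ⟨_, _, inferInstance, _, hA.toDRep h.symm (h.diag a) ha hσ hS hN h4 hγ⟩)
    · obtain ⟨b, hb⟩ := hA.exists_ERep h ha hc.2 hc.1.symm hσ hK h6 h8
        (fun t ht => by simpa only [hγK] using hγ t ht)
      exact Or.inr (Or.inr ⟨_, _, hb⟩)
  · rcases hD.functional_cases h ha hc.2 hd.2 hc.1.symm hd.1.symm hcd hadj with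
      ⟨i, ε, hε, hγ⟩ | ⟨h7, ε, hε, hγ⟩
    · exact Or.inr (Or.inl ⟨_, _, inferInstance, _, hD.extend h.symm (h.diag a) ha hε hγ⟩)
    · have h4 : 4 ≤ Fintype.card ι := hD.card ▸ hD.four_le
      rcases h4.eq_or_lt with h4 | h4
      · obtain ⟨u', hD', i, η, hη, hγ'⟩ := hD.exists_reflect h4.symm hε hγ
        exact Or.inr (Or.inl ⟨_, _, inferInstance, _, hD'.extend h.symm (h.diag a) ha hη hγ'⟩)
      · obtain ⟨b, hb⟩ := hD.exists_ERep h ha hc.2 hc.1.symm hε h4 h7 hγ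
        exact Or.inr (Or.inr ⟨_, _, hb⟩)
  · obtain ⟨b', hb'⟩ := hE.grow h ha hc.2 hd.2 hc.1.symm hd.1.symm hcd hadj
    exact Or.inr (Or.inr ⟨_, _, hb'⟩)

lemma Critical.exists_isADE (h : Critical G) (s : ℕ) (hs : s + 3 ≤ Fintype.card V) :
    ∃ T : Finset V, T.card = s + 1 ∧ IsADE G T := by
  induction s with
  | zero =>
    obtain ⟨a⟩ : Nonempty V := Fintype.card_pos_iff.mp (by omega)
    exact ⟨{a}, by simp, isADE_singleton h a⟩
  | succ s ih =>
    obtain ⟨T, hTc, hT⟩ := ih (by omega)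
    obtain ⟨a, ha, haT⟩ := hT.exists_insert h (Finset.card_pos.mp (by omega)) (by omega)
    exact ⟨insert a T, by rw [Finset.card_insert_of_notMem ha, hTc], haT⟩

end Growth

section Full

variable {V : Type} [Fintype V] [DecidableEq V] {ι : Type} [Fintype ι]
variable {G : V → V → ℤ} {T : Finset V} {u : V → ι → ℤ}

omit [Fintype V] [DecidableEq V] in
lemma sum_mul_eq_zero_of_mem_span {w z : ι → ℤ} (hw : ∀ t ∈ T, ∑ k, w k * u t k = 0)
    (hz : z ∈ Submodule.span ℤ (u '' (T : Set V))) : ∑ k, w k * z k = 0 := by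
  induction hz using Submodule.span_induction with
  | mem z hz =>
    obtain ⟨t, ht, rfl⟩ := hz
    exact hw t (by simpa using ht)
  | zero => simp
  | add z y _ _ hz hy => simp [mul_add, Finset.sum_add_distrib, hz, hy]
  | smul c z _ hz =>
    have : ∑ k, w k * (c • z) k = c * ∑ k, w k * z k := by
      rw [Finset.mul_sum]
      exact Finset.sum_congr rfl fun k _ => by simp; ring
    rw [this, hz, mul_zero]

/-- Vectors orthogonal to a cut functional do not involve the cut element. -/
lemma mem_evRange_erase {w : ι → ℤ} {c : V} (hw : ∀ t ∈ T, t ≠ c → ∑ k, w k * u t k = 0)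
    (hwc : ∑ k, w k * u c k ≠ 0) {z : ι → ℝ} (hz : z ∈ evRange T u)
    (hwz : ∑ k, (w k : ℝ) * z k = 0) : z ∈ evRange (T.erase c) u := by
  obtain ⟨y, hy, hyz⟩ := hz
  refine ⟨y, fun i hi => ?_, hyz⟩
  by_cases hic : i = c
  · subst hic
    have h1 : ∑ k, (w k : ℝ) * z k = ∑ t, y t * (∑ k, w k * u t k : ℤ) := by
      simp only [← hyz, ev]
      push_cast
      simp only [Finset.mul_sum]
      rw [Finset.sum_comm]
      exact Finset.sum_congr rfl fun t _ => Finset.sum_congr rfl fun k _ => by ring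
    rw [h1, Finset.sum_eq_single i] at hwz
    · exact (mul_eq_zero.mp hwz).resolve_right (by exact_mod_cast hwc)
    · intro t _ hti
      by_cases ht : t ∈ T
      · rw [hw t ht hti]; simp
      · simp [hy t ht]
    · simp
  · exact hy i fun hiT => hi (Finset.mem_erase.mpr ⟨hic, hiT⟩)

/-- Expansion of the form on two extra vectors. -/
lemma bil_two_extra (h : Critical G) {a b : V}
    (hu : ∀ s ∈ T, ∀ t ∈ T, ∑ k, u s k * u t k = G s t) {α β : ι → ℤ}
    (hα : ∀ t ∈ T, ∑ k, α k * u t k = G a t) (hβ : ∀ t ∈ T, ∑ k, β k * u t k = G b t)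
    {y : V → ℝ} (hy : ∀ i, i ∉ T → y i = 0) (s r : ℝ) :
    bil G ((s • stdVec a + r • stdVec b) + (1 : ℝ) • y)
        ((s • stdVec a + r • stdVec b) + (1 : ℝ) • y)
      = ((2 - ∑ k, α k ^ 2 : ℤ) * s ^ 2 + 2 * (G a b - ∑ k, α k * β k : ℤ) * s * r
        + (2 - ∑ k, β k ^ 2 : ℤ) * r ^ 2) + ∑ k, (s * α k + r * β k + ev u y k) ^ 2 := by
  rw [bil_add_smul h.symm, bil_add_smul h.symm, bil_eq_of_gram hu hy hy]
  simp only [map_add, map_smul, LinearMap.add_apply, LinearMap.smul_apply, smul_eq_mul]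
  rw [bil_stdVec_eq (cast_functional hα) hy, bil_stdVec_eq (cast_functional hβ) hy]
  simp only [bil_stdVec_stdVec, h.diag]
  have h1 : ∑ k, (s * α k + r * β k + ev u y k) ^ 2
      = s ^ 2 * ∑ k, (α k : ℝ) ^ 2 + r ^ 2 * ∑ k, (β k : ℝ) ^ 2 + ∑ k, ev u y k * ev u y k
        + 2 * s * r * ∑ k, (α k : ℝ) * β k + 2 * s * ∑ k, (α k : ℝ) * ev u y k
        + 2 * r * ∑ k, (β k : ℝ) * ev u y k := by
    simp only [Finset.mul_sum, ← Finset.sum_add_distrib]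
    exact Finset.sum_congr rfl fun k _ => by ring
  rw [h1]
  push_cast
  ring

/-- The setting of a critical matrix with all but two vertices represented. -/
structure Remainder (G : V → V → ℤ) (T : Finset V) (u : V → ι → ℤ) (a b : V) (α β : ι → ℤ) :
    Prop where
  crit : Critical G
  ne : a ≠ b
  left_notMem : a ∉ T
  right_notMem : b ∉ T
  cover : ∀ v, v ∉ T → v = a ∨ v = b
  gram : ∀ s ∈ T, ∀ t ∈ T, ∑ k, u s k * u t k = G s t
  left : ∀ t ∈ T, ∑ k, α k * u t k = G a t
  right : ∀ t ∈ T, ∑ k, β k * u t k = G b t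

namespace Remainder

variable {a b : V} {α β : ι → ℤ}

lemma swap (hR : Remainder G T u a b α β) : Remainder G T u b a β α :=
  ⟨hR.crit, hR.ne.symm, hR.right_notMem, hR.left_notMem, fun v hv => (hR.cover v hv).symm,
    hR.gram, hR.right, hR.left⟩

lemma not_nonneg (hR : Remainder G T u a b α β)
    (hQ : ∀ s r : ℝ, 0 ≤ (2 - ∑ k, α k ^ 2 : ℤ) * s ^ 2
      + 2 * (G a b - ∑ k, α k * β k : ℤ) * s * r + (2 - ∑ k, β k ^ 2 : ℤ) * r ^ 2) : False := by
  obtain ⟨x, hx⟩ := hR.crit.neg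
  set y : V → ℝ := fun v => if v ∈ T then x v else 0 with hy
  have hy0 : ∀ i, i ∉ T → y i = 0 := fun i hi => by simp [hy, hi]
  have h1 : x = (x a • stdVec a + x b • stdVec b) + (1 : ℝ) • y := by
    ext v
    by_cases hv : v ∈ T
    · have hva : v ≠ a := fun hva => hR.left_notMem (hva ▸ hv)
      have hvb : v ≠ b := fun hvb => hR.right_notMem (hvb ▸ hv)
      simp [stdVec, hva, hvb, hy, hv]
    · rcases hR.cover v hv with rfl | rfl
      · simp [stdVec, hR.ne, hy, hv]
      · simp [stdVec, hR.ne.symm, hy, hv]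
  rw [h1, bil_two_extra hR.crit hR.gram hR.left hR.right hy0] at hx
  have h2 := hQ (x a) (x b)
  have h3 : 0 ≤ ∑ k, (x a * α k + x b * β k + ev u y k) ^ 2 :=
    Finset.sum_nonneg fun k _ => sq_nonneg _
  linarith

lemma cut_nonneg (hR : Remainder G T u a b α β) {c : V} (hc : c ∈ T) {z : ι → ℝ}
    (hz : z ∈ evRange (T.erase c) u) (s r : ℝ) :
    0 ≤ ((2 - ∑ k, α k ^ 2 : ℤ) * s ^ 2 + 2 * (G a b - ∑ k, α k * β k : ℤ) * s * r
        + (2 - ∑ k, β k ^ 2 : ℤ) * r ^ 2) + ∑ k, (s * α k + r * β k + z k) ^ 2 := by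
  obtain ⟨y, hy, hyz⟩ := hz
  have hyT : ∀ i, i ∉ T → y i = 0 := fun i hi => hy i fun h => hi (Finset.mem_of_mem_erase h)
  simp only [← hyz]
  rw [← bil_two_extra hR.crit hR.gram hR.left hR.right hyT]
  refine hR.crit.nonneg _ ⟨c, ?_⟩
  have hca : c ≠ a := fun h => hR.left_notMem (h ▸ hc)
  have hcb : c ≠ b := fun h => hR.right_notMem (h ▸ hc)
  simp [stdVec, hca, hcb, hy c (Finset.notMem_erase c T)]

end Remainder

variable [DecidableEq ι]

/-- In type `D` some fundamental weight is spinorial. -/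
lemma DRep.exists_sign_cut (h : Critical G) (hD : DRep G T u) {a b : V} (hab : a ≠ b)
    (ha : a ∉ T) (hb : b ∉ T) :
    ∃ c ∈ T, ∃ σ : ι → ℤ, (∀ k, σ k = 1 ∨ σ k = -1) ∧
      ∀ t ∈ T, t ≠ c → ∑ k, σ k * u t k = 0 := by
  have hu2 : ∀ t ∈ T, ∑ k, u t k ^ 2 = 2 := fun t ht => by
    simpa only [← sq, h.diag] using hD.gram t ht t ht
  choose w hw using fun c => exists_functional (ev_injective h hab ha hb hD.gram)
    (fun t => ((Pi.single c 1 : V → ℤ) t : ℝ))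
  by_cases hentry : ∀ c ∈ T, ∃ γ : ι → ℤ, ∀ k, w c k = γ k
  · exfalso
    choose! γ hγ using hentry
    obtain ⟨i⟩ : Nonempty ι := Fintype.card_pos_iff.mp (by have := hD.card; have := hD.four_le; omega)
    obtain ⟨y, hy, hyz⟩ := hD.mem_evRange (Pi.single i 1)
    have h1 : ∀ t ∈ T, y t = γ t i := by
      intro t ht
      have h2 : ∑ k, w t k * ev u y k = y t := by
        have h3 : ∑ k, w t k * ev u y k = ∑ v, y v * ∑ k, w t k * (u v k : ℝ) := by
          simp only [ev, Finset.mul_sum]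
          rw [Finset.sum_comm]
          exact Finset.sum_congr rfl fun v _ => Finset.sum_congr rfl fun k _ => by ring
        rw [h3, Finset.sum_eq_single t]
        · rw [hw t t ht]; simp
        · intro v _ hvt
          by_cases hv : v ∈ T
          · rw [hw t v hv]; simp [hvt]
          · simp [hy v hv]
        · simp
      rw [← h2, ← hγ t ht i]
      simp [hyz, Pi.single_apply]
    have h2 : ∑ k, ∑ t ∈ T, γ t i * u t k = 1 := by
      have h3 : ∀ k, ((∑ t ∈ T, γ t i * u t k : ℤ) : ℝ) = (Pi.single i 1 : ι → ℝ) k := by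
        intro k
        rw [← hyz k, ev, ← Finset.sum_subset (Finset.subset_univ T)
          (fun v _ hv => by simp [hy v hv])]
        push_cast
        exact Finset.sum_congr rfl fun t ht => by rw [h1 t ht]
      have h4 : ((∑ k, ∑ t ∈ T, γ t i * u t k : ℤ) : ℝ) = 1 := by
        rw [Int.cast_sum]
        simp [h3]
      exact_mod_cast h4
    have h3 : Even (∑ k, ∑ t ∈ T, γ t i * u t k) := by
      rw [Finset.sum_comm]
      refine Finset.even_sum _ fun t ht => ?_
      rw [← Finset.mul_sum]
      refine Even.mul_left ?_ _
      obtain ⟨p, q, ε, η, -, hε, hη, hpq⟩ := eq_single_add_single_of_sum_sq_eq_two (hu2 t ht)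
      rw [hpq]
      simp only [Pi.add_apply, Finset.sum_add_distrib, Finset.sum_pi_single', Finset.mem_univ,
        if_true]
      rcases hε with rfl | rfl <;> rcases hη with rfl | rfl <;> decide
    rw [h2] at h3
    exact absurd h3 (by decide)
  · push Not at hentry
    obtain ⟨c, hc, hcγ⟩ := hentry
    obtain ⟨n, hn, hwn⟩ : ∃ n : ι → ℤ, (∀ k, Odd (n k)) ∧ ∀ k, w c k = n k / 2 := by
      rcases hD.functional_half (hw c) with ⟨γ, hγ⟩ | hn
      · obtain ⟨k, hk⟩ := hcγ γ
        exact absurd (hγ k) hk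
      · exact hn
    refine ⟨c, hc, fun k => (n k).sign, fun k => ?_, fun t ht htc => ?_⟩
    · have : n k ≠ 0 := by
        intro h0; have := hn k; rw [h0] at this; exact absurd this (by decide)
      rcases lt_or_gt_of_ne this with h1 | h1
      · exact Or.inr (Int.sign_eq_neg_one_of_neg h1)
      · exact Or.inl (Int.sign_eq_one_of_pos h1)
    · have h1 : ∑ k, n k * u t k = 0 := by
        have h2 := hw c t ht
        simp only [hwn, Pi.single_eq_of_ne htc, Int.cast_zero] at h2
        have h3 : ∑ k, (n k : ℝ) * u t k = 0 := by
          have : ∑ k, (n k : ℝ) * u t k = 2 * ∑ k, (n k : ℝ) / 2 * u t k := by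
            rw [Finset.mul_sum]
            exact Finset.sum_congr rfl fun k _ => by ring
          rw [this, h2, mul_zero]
        exact_mod_cast h3
      obtain ⟨p, q, ε, η, hpq, hε, hη, hu⟩ := eq_single_add_single_of_sum_sq_eq_two (hu2 t ht)
      rw [hu] at h1 ⊢
      simp only [Pi.add_apply, mul_add, Finset.sum_add_distrib, Pi.single_apply, mul_ite, mul_zero,
        Finset.sum_ite_eq', Finset.mem_univ, if_true] at h1 ⊢
      have h2 : n p = -(ε * η) * n q := by
        rcases hε with rfl | rfl <;> rcases hη with rfl | rfl <;> linarith
      rw [h2, Int.sign_mul]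
      rcases hε with rfl | rfl <;> rcases hη with rfl | rfl <;> simp

omit [DecidableEq ι] in
/-- Reducing to a nonnegativity statement about integral residuals. -/
lemma Remainder.sum_sq_gt {a b : V} {α β : ι → ℤ} (hR : Remainder G T u a b α β)
    (hA : ∑ k, α k ^ 2 ≤ 2) (hB : ∑ k, β k ^ 2 ≤ 2) :
    (2 - ∑ k, α k ^ 2) * (2 - ∑ k, β k ^ 2) < (G a b - ∑ k, α k * β k) ^ 2 := by
  by_contra hcon
  push Not at hcon
  refine hR.not_nonneg fun s r => quadratic_nonneg ?_ ?_ ?_ s r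
  · exact_mod_cast sub_nonneg.mpr hA
  · exact_mod_cast sub_nonneg.mpr hB
  · exact_mod_cast hcon

omit [DecidableEq ι] in
/-- The centred projection killing a sign functional. -/
lemma sum_sub_proj_sq [Nonempty ι] {σ : ι → ℤ} (hσ : ∀ k, σ k = 1 ∨ σ k = -1) (f : ι → ℝ) :
    ∃ z : ι → ℝ, ∑ k, (σ k : ℝ) * z k = 0 ∧
      ∑ k, (f k + z k) ^ 2 = (∑ k, (σ k : ℝ) * f k) ^ 2 / Fintype.card ι := by
  have hσ2 : ∀ k, (σ k : ℝ) ^ 2 = 1 := fun k => by rcases hσ k with h | h <;> simp [h]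
  have hm : (Fintype.card ι : ℝ) ≠ 0 := by exact_mod_cast Fintype.card_ne_zero
  set S := ∑ k, (σ k : ℝ) * f k with hS
  refine ⟨fun k => -f k + S / Fintype.card ι * σ k, ?_, ?_⟩
  · have h1 : ∀ k, (σ k : ℝ) * (-f k + S / Fintype.card ι * σ k)
        = -(σ k * f k) + S / Fintype.card ι := fun k => by
      linear_combination (S / Fintype.card ι) * hσ2 k
    simp only [h1, Finset.sum_add_distrib, Finset.sum_neg_distrib, ← hS, Finset.sum_const,
      Finset.card_univ, nsmul_eq_mul]
    field_simp; ring
  · have h1 : ∀ k, (f k + (-f k + S / Fintype.card ι * σ k)) ^ 2 = (S / Fintype.card ι) ^ 2 :=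
      fun k => by linear_combination (S / Fintype.card ι) ^ 2 * hσ2 k
    simp only [h1, Finset.sum_const, Finset.card_univ, nsmul_eq_mul]
    field_simp

lemma DRep.functional_int (h : Critical G) (hD : DRep G T u) {a b : V} (hab : a ≠ b)
    (ha : a ∉ T) (hb : b ∉ T) (h9 : 9 ≤ T.card) :
    ∃ γ : ι → ℤ, (∀ t ∈ T, ∑ k, γ k * u t k = G a t) ∧ ∑ k, γ k ^ 2 ≤ 2 := by
  obtain ⟨α, hα⟩ := exists_functional (ev_injective h hab ha hb hD.gram) (fun t => (G a t : ℝ))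
  have h1 := h.two_sub_nonneg hab hb hD.gram hα (hD.mem_evRange α)
  have h2 : ∑ k, α k ^ 2 ≤ 2 := by
    simp only [← sq] at h1; linarith
  rcases hD.functional_half (g := G a) hα with ⟨γ, hγ⟩ | ⟨n, hn, hαn⟩
  · refine ⟨γ, fun t ht => ?_, ?_⟩
    · have := hα t ht
      simp only [hγ] at this
      exact_mod_cast this
    · simp only [hγ] at h2
      exact_mod_cast h2
  · exfalso
    have h3 : ∀ k ∈ Finset.univ, (1 / 4 : ℝ) ≤ α k ^ 2 := by
      intro k _
      have : (1 : ℝ) ≤ (n k : ℝ) ^ 2 := by exact_mod_cast one_le_sq_of_odd (hn k)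
      rw [hαn k]; linarith
    have h4 := Finset.card_nsmul_le_sum _ _ _ h3
    rw [Finset.card_univ, hD.card, nsmul_eq_mul] at h4
    have h5 : (9 : ℝ) ≤ T.card := by exact_mod_cast h9
    linarith

lemma DRep.false_of_nine_le_card (h : Critical G) (hD : DRep G T u) {a b : V} (hab : a ≠ b)
    (ha : a ∉ T) (hb : b ∉ T) (hcov : ∀ v, v ∉ T → v = a ∨ v = b) (h9 : 9 ≤ T.card) : False := by
  obtain ⟨α, hα, hA⟩ := hD.functional_int h hab ha hb h9
  obtain ⟨β, hβ, hB⟩ := hD.functional_int h hab.symm hb ha h9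
  have hR : Remainder G T u a b α β := ⟨h, hab, ha, hb, hcov, hD.gram, hα, hβ⟩
  obtain ⟨c, hc, σ, hσ, hσu⟩ := hD.exists_sign_cut h hab ha hb
  have : Nonempty ι := Fintype.card_pos_iff.mp (by rw [hD.card]; omega)
  have hσ1 : ∀ k, |σ k| ≤ 1 := fun k => by rcases hσ k with h | h <;> simp [h]
  have hσc : ∑ k, σ k * u c k ≠ 0 := by
    intro h0
    obtain ⟨i⟩ := this
    have h1 := sum_mul_eq_zero_of_mem_span (w := σ) (fun t ht => by
      by_cases htc : t = c
      · rw [htc, h0]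
      · exact hσu t ht htc) (hD.span (Pi.single i 2) (by simp))
    simp [Pi.single_apply] at h1
    rcases hσ i with h | h <;> omega
  have h1 := residual_det_le (g := G a b - ∑ k, α k * β k)
    (Finset.sum_nonneg fun k _ => sq_nonneg (α k)) hA
    (Finset.sum_nonneg fun k _ => sq_nonneg (β k)) hB (abs_dot_le_sum_sq hσ1)
    (abs_dot_le_sum_sq hσ1) (m := Fintype.card ι) (by rw [hD.card]; exact_mod_cast h9)
    fun s r => by
      obtain ⟨z, hz, hzs⟩ := sum_sub_proj_sq hσ fun k => s * (α k : ℝ) + r * β k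
      have h2 := hR.cut_nonneg hc (mem_evRange_erase hσu hσc (hD.mem_evRange z) hz) s r
      rw [hzs] at h2
      have h3 : ∑ k, (σ k : ℝ) * (s * (α k : ℝ) + r * β k)
          = s * (∑ k, σ k * α k : ℤ) + r * (∑ k, σ k * β k : ℤ) := by
        push_cast
        simp only [Finset.mul_sum, ← Finset.sum_add_distrib]
        exact Finset.sum_congr rfl fun k _ => by ring
      rw [h3] at h2
      push_cast at h2 ⊢
      exact h2
  exact absurd (hR.sum_sq_gt hA hB) (not_lt.mpr h1)

end Full

section TypeA

variable {V : Type} [Fintype V] [DecidableEq V] {ι : Type} [Fintype ι] [DecidableEq ι]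
variable {G : V → V → ℤ} {T : Finset V} {u : V → ι → ℤ}

namespace ARep

lemma functional_int (h : Critical G) (hA : ARep G T u) {a b : V} (hab : a ≠ b)
    (ha : a ∉ T) (hb : b ∉ T) (h9 : 9 ≤ T.card) :
    ∃ γ : ι → ℤ, (∀ t ∈ T, ∑ k, γ k * u t k = G a t) ∧ ∑ k, γ k ^ 2 ≤ 2 := by
  have hm : 10 ≤ Fintype.card ι := by rw [hA.card]; omega
  have : Nonempty ι := Fintype.card_pos_iff.mp (by omega)
  obtain ⟨α, hα⟩ := exists_functional (ev_injective h hab ha hb hA.gram) (fun t => (G a t : ℝ))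
  obtain ⟨γ, hγ, hS⟩ := hA.exists_int_functional hα
  obtain ⟨z, hz, hzγ⟩ := sum_centred γ
  have h1 := h.two_sub_nonneg hab hb hA.gram (cast_functional hγ) (hA.mem_evRange hz)
  have hm0 : (0 : ℝ) < Fintype.card ι := by exact_mod_cast (by omega : 0 < Fintype.card ι)
  rw [hzγ] at h1
  replace h1 := mul_nonneg h1 hm0.le
  rw [div_mul_cancel₀ _ hm0.ne'] at h1
  have h2 : 0 ≤ 2 * (Fintype.card ι : ℤ)
      - (Fintype.card ι * ∑ k, γ k ^ 2 - (∑ k, γ k) ^ 2) := by exact_mod_cast h1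
  have h4 := sum_sq_le_four hS (by linarith) (by omega)
  refine ⟨γ, hγ, ?_⟩
  have h5 : (∑ k, γ k) ^ 2 ≤ (∑ k, γ k ^ 2) ^ 2 := sq_le_sq' (by
    have := abs_le.mp (abs_sum_le_sum_sq γ); linarith) (abs_le.mp (abs_sum_le_sum_sq γ)).2
  have hm' : (10 : ℤ) ≤ Fintype.card ι := by exact_mod_cast hm
  by_contra hcon
  have h6 : ∑ k, γ k ^ 2 = 3 ∨ ∑ k, γ k ^ 2 = 4 := by omega
  rcases h6 with h6 | h6 <;> rw [h6] at h2 h5 <;> linarith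

omit [Fintype V] [DecidableEq V] in
/-- A family of edges spanning all differences separates no proper subset. -/
lemma exists_sum_ne_zero (hA : ARep G T u) {P : Finset ι} {x y : ι} (hx : x ∈ P) (hy : y ∉ P) :
    ∃ t ∈ T, ∑ k ∈ P, u t k ≠ 0 := by
  by_contra hcon
  push Not at hcon
  have h1 := sum_mul_eq_zero_of_mem_span (w := fun k => if k ∈ P then 1 else 0) (fun t ht => by
    simpa [Finset.sum_ite_mem] using hcon t ht)
    (hA.span (Pi.single x 1 - Pi.single y 1) (by simp [Finset.sum_sub_distrib]))
  simp [mul_sub, Finset.sum_sub_distrib, Pi.single_apply, hx, hy] at h1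

lemma cut_nonneg (hA : ARep G T u) {a b : V} {α β : ι → ℤ} (hR : Remainder G T u a b α β)
    {P : Finset ι} {x y : ι} (hx : x ∈ P) (hy : y ∉ P) {c : V} (hc : c ∈ T)
    (hcut : ∀ t ∈ T, t ≠ c → ∑ k ∈ P, u t k = 0) (s r : ℝ) :
    0 ≤ ((2 - ∑ k, α k ^ 2 : ℤ) * s ^ 2 + 2 * (G a b - ∑ k, α k * β k : ℤ) * s * r
        + (2 - ∑ k, β k ^ 2 : ℤ) * r ^ 2)
      + (s * (∑ k ∈ P, α k : ℤ) + r * (∑ k ∈ P, β k : ℤ)) ^ 2 / P.card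
      + (s * (∑ k ∈ Pᶜ, α k : ℤ) + r * (∑ k ∈ Pᶜ, β k : ℤ)) ^ 2 / Pᶜ.card := by
  set f : ι → ℝ := fun k => s * α k + r * β k with hf
  set z : ι → ℝ := fun k => -f k + if k ∈ P then (∑ l ∈ P, f l) / P.card
    else (∑ l ∈ Pᶜ, f l) / Pᶜ.card with hz
  have hP0 : (P.card : ℝ) ≠ 0 := by
    exact_mod_cast (Finset.card_pos.mpr ⟨x, hx⟩).ne'
  have hQ0 : (Pᶜ.card : ℝ) ≠ 0 := by
    exact_mod_cast (Finset.card_pos.mpr ⟨y, Finset.mem_compl.mpr hy⟩).ne'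
  have hzP : ∀ k ∈ P, z k = -f k + (∑ l ∈ P, f l) / P.card := fun k hk => by simp [hz, hk]
  have hzQ : ∀ k ∈ Pᶜ, z k = -f k + (∑ l ∈ Pᶜ, f l) / Pᶜ.card := fun k hk => by
    simp [hz, Finset.mem_compl.mp hk]
  have hsP : ∑ k ∈ P, z k = 0 := by
    rw [Finset.sum_congr rfl hzP, Finset.sum_add_distrib, Finset.sum_neg_distrib, Finset.sum_const,
      nsmul_eq_mul]
    field_simp; ring
  have hsQ : ∑ k ∈ Pᶜ, z k = 0 := by
    rw [Finset.sum_congr rfl hzQ, Finset.sum_add_distrib, Finset.sum_neg_distrib, Finset.sum_const,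
      nsmul_eq_mul]
    field_simp; ring
  have hs : ∑ k, z k = 0 := by rw [← Finset.sum_add_sum_compl P, hsP, hsQ, add_zero]
  have hcc : ∑ k ∈ P, u c k ≠ 0 := by
    obtain ⟨t, ht, htP⟩ := hA.exists_sum_ne_zero hx hy
    by_cases htc : t = c
    · rwa [htc] at htP
    · exact absurd (hcut t ht htc) htP
  have h1 := hR.cut_nonneg hc (mem_evRange_erase (w := fun k => if k ∈ P then 1 else 0)
    (fun t ht htc => by simpa [Finset.sum_ite_mem] using hcut t ht htc)
    (by simpa [Finset.sum_ite_mem] using hcc) (hA.mem_evRange hs)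
    (by simpa [Finset.sum_ite_mem] using hsP)) s r
  have h2 : ∑ k, (s * (α k : ℝ) + r * β k + z k) ^ 2
      = (∑ k ∈ P, f k) ^ 2 / P.card + (∑ k ∈ Pᶜ, f k) ^ 2 / Pᶜ.card := by
    rw [← Finset.sum_add_sum_compl P]
    congr 1
    · rw [Finset.sum_congr rfl (g := fun _ => ((∑ l ∈ P, f l) / P.card) ^ 2)
        fun k hk => by rw [hzP k hk, hf]; ring]
      rw [Finset.sum_const, nsmul_eq_mul]
      field_simp
    · rw [Finset.sum_congr rfl (g := fun _ => ((∑ l ∈ Pᶜ, f l) / Pᶜ.card) ^ 2)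
        fun k hk => by rw [hzQ k hk, hf]; ring]
      rw [Finset.sum_const, nsmul_eq_mul]
      field_simp
  have h3 : ∀ S : Finset ι, ∑ k ∈ S, f k = s * (∑ k ∈ S, α k : ℤ) + r * (∑ k ∈ S, β k : ℤ) := by
    intro S
    push_cast
    simp only [hf, Finset.mul_sum, Finset.sum_add_distrib]
  rw [h2, h3, h3] at h1
  linarith

/-- The edges at a coordinate. -/
def edges (T : Finset V) (u : V → ι → ℤ) (v : ι) : Finset V := T.filter fun t => u t v ≠ 0

omit [Fintype ι] [DecidableEq ι] [Fintype V] [DecidableEq V] in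
lemma mem_edges {v : ι} {t : V} : t ∈ edges T u v ↔ t ∈ T ∧ u t v ≠ 0 := Finset.mem_filter

omit [Fintype V] [DecidableEq V] in
lemma one_le_card_edges (hA : ARep G T u) (hT : 1 ≤ T.card) (v : ι) : 1 ≤ (edges T u v).card := by
  obtain ⟨w, hw⟩ : ∃ w, w ≠ v := Fintype.exists_ne_of_one_lt_card (by rw [hA.card]; omega) v
  obtain ⟨t, ht, htv⟩ := hA.exists_sum_ne_zero (P := {v}) (x := v) (y := w) (by simp) (by simpa)
  exact Finset.card_pos.mpr ⟨t, mem_edges.mpr ⟨ht, by simpa using htv⟩⟩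

omit [DecidableEq ι] in
lemma sum_card_edges (h : Critical G) (hA : ARep G T u) :
    ∑ v, (edges T u v).card = 2 * T.card := by
  have h1 : ∀ t ∈ T, (Finset.univ.filter fun v => u t v ≠ 0).card = 2 := by
    intro t ht
    have h2 : ∑ k, u t k ^ 2 = 2 := by simpa only [← sq, h.diag] using hA.gram t ht t ht
    have h3 := card_support_eq_sum_sq (γ := u t) (by omega)
    omega
  have h2 : ∑ v, (edges T u v).card = ∑ t ∈ T, (Finset.univ.filter fun v => u t v ≠ 0).card := by
    simp only [edges, Finset.card_filter]
    exact Finset.sum_comm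
  rw [h2, Finset.sum_congr rfl h1, Finset.sum_const, smul_eq_mul, mul_comm]

/-- Counting leaves of the tree formed by the edges. -/
lemma two_le_card_leaves (h : Critical G) (hA : ARep G T u) (hT : 1 ≤ T.card) {X : Finset ι}
    (hX : ∀ v, (edges T u v).card = 1 → v ∈ X) :
    2 ≤ X.card ∧ (X.card = 2 → ∀ v, (edges T u v).card = if v ∈ X then 1 else 2) := by
  have hle : ∀ v ∈ Finset.univ, (if v ∈ X then 1 else 2) ≤ (edges T u v).card := by
    intro v _
    have h1 := hA.one_le_card_edges hT v
    split_ifs with hv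
    · exact h1
    · have : (edges T u v).card ≠ 1 := fun h => hv (hX v h)
      omega
  have h1 := Finset.sum_le_sum hle
  have h2 : ∑ v, (if v ∈ X then 1 else 2) + X.card = 2 * Fintype.card ι := by
    have : ∀ v, (if v ∈ X then 1 else 2) + (if v ∈ X then 1 else 0) = 2 := by
      intro v; split_ifs <;> rfl
    have h3 : X.card = ∑ v, if v ∈ X then 1 else 0 := by simp
    rw [h3, ← Finset.sum_add_distrib, Finset.sum_congr rfl fun v _ => this v]
    simp [mul_comm]
  rw [hA.sum_card_edges h] at h1
  have h3 := hA.card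
  refine ⟨by omega, fun hX2 v => ?_⟩
  have h4 : ∑ v, (if v ∈ X then 1 else 2) = ∑ v, (edges T u v).card := by
    rw [hA.sum_card_edges h]; omega
  exact ((Finset.sum_eq_sum_iff_of_le hle).mp h4 v (Finset.mem_univ v)).symm

lemma leaf_le (hA : ARep G T u) (h9 : 9 ≤ T.card) {a b : V} {α β : ι → ℤ}
    (hR : Remainder G T u a b α β) (hα : ∑ k, α k ^ 2 ≤ 2) (hβ : ∑ k, β k ^ 2 ≤ 2) {v : ι}
    (hv : (edges T u v).card = 1) :
    (G a b - ∑ k, α k * β k + α v * β v) ^ 2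
      ≤ (2 - ∑ k, α k ^ 2 + α v ^ 2) * (2 - ∑ k, β k ^ 2 + β v ^ 2) := by
  obtain ⟨c, hc⟩ := Finset.card_eq_one.mp hv
  have hcT : c ∈ T := (mem_edges.mp (hc ▸ Finset.mem_singleton_self c)).1
  have hcut : ∀ t ∈ T, t ≠ c → ∑ k ∈ ({v} : Finset ι), u t k = 0 := by
    intro t ht htc
    rw [Finset.sum_singleton]
    by_contra h0
    have : t ∈ edges T u v := mem_edges.mpr ⟨ht, h0⟩
    rw [hc, Finset.mem_singleton] at this
    exact htc this
  obtain ⟨w, hw⟩ : ∃ w, w ≠ v := Fintype.exists_ne_of_one_lt_card (by rw [hA.card]; omega) v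
  have hcomp : ∀ γ : ι → ℤ, ∑ k, γ k ^ 2 = γ v ^ 2 + ∑ k ∈ {v}ᶜ, γ k ^ 2 := fun γ => by
    rw [← Finset.sum_add_sum_compl {v}, Finset.sum_singleton]
  have hnn : ∀ γ : ι → ℤ, 0 ≤ ∑ k ∈ {v}ᶜ, γ k ^ 2 := fun γ =>
    Finset.sum_nonneg fun k _ => sq_nonneg _
  have habs : ∀ γ : ι → ℤ, |∑ k ∈ {v}ᶜ, γ k| ≤ ∑ k ∈ {v}ᶜ, γ k ^ 2 := fun γ =>
    (Finset.abs_sum_le_sum_abs _ _).trans (Finset.sum_le_sum fun k _ => int_abs_le_sq _)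
  have hcard : (({v}ᶜ : Finset ι).card : ℝ) = T.card := by
    rw [Finset.card_compl, Finset.card_singleton, hA.card]; simp
  have h1 := residual_det_le (A := ∑ k ∈ {v}ᶜ, α k ^ 2) (B := ∑ k ∈ {v}ᶜ, β k ^ 2)
    (g := G a b - ∑ k, α k * β k + α v * β v) (hnn α)
    (by have := hcomp α; have := sq_nonneg (α v); linarith) (hnn β)
    (by have := hcomp β; have := sq_nonneg (β v); linarith) (habs α) (habs β) (m := T.card)
    (by exact_mod_cast h9) fun s r => by
      have h2 := hA.cut_nonneg hR (Finset.mem_singleton_self v) (y := w) (by simpa) hcT hcut s r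
      rw [hcard, hcomp α, hcomp β] at h2
      simp only [Finset.sum_singleton, Finset.card_singleton] at h2
      push_cast at h2 ⊢
      linarith
  rw [hcomp α, hcomp β]
  calc _ ≤ _ := h1
    _ = _ := by ring

/-- In a path, initial segments of every size are cut off by a single edge. -/
lemma exists_initial_segment (h : Critical G) (hA : ARep G T u) {i j : ι} (hij : i ≠ j)
    (hi : (edges T u i).card = 1) (hj : (edges T u j).card = 1)
    (h2 : ∀ v, (edges T u v).card ≤ 2) (p : ℕ) (hp : p < T.card) :
    ∃ P : Finset ι, P.card = p + 1 ∧ i ∈ P ∧ j ∉ P ∧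
      ∃ c ∈ T, ∀ t ∈ T, t ≠ c → ∑ k ∈ P, u t k = 0 := by
  induction p with
  | zero =>
    obtain ⟨c, hc⟩ := Finset.card_eq_one.mp hi
    refine ⟨{i}, by simp, by simp, by simpa using hij.symm, c,
      (mem_edges.mp (hc ▸ Finset.mem_singleton_self c)).1, fun t ht htc => ?_⟩
    rw [Finset.sum_singleton]
    by_contra h0
    have : t ∈ edges T u i := mem_edges.mpr ⟨ht, h0⟩
    rw [hc, Finset.mem_singleton] at this
    exact htc this
  | succ p ih =>
    obtain ⟨P, hPc, hiP, hjP, c, hc, hcut⟩ := ih (by omega)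
    have hcc : ∑ k ∈ P, u c k ≠ 0 := by
      obtain ⟨t, ht, htP⟩ := hA.exists_sum_ne_zero hiP hjP
      by_cases htc : t = c
      · rwa [htc] at htP
      · exact absurd (hcut t ht htc) htP
    have hu2 : ∑ k, u c k ^ 2 = 2 := by simpa only [← sq, h.diag] using hA.gram c hc c hc
    have hu0 := hA.sum_zero c hc
    obtain ⟨y, hyP, hyc⟩ : ∃ y, y ∉ P ∧ (u c y ≠ 0 ∧ ∑ k ∈ P, u c k + u c y = 0) := by
      obtain ⟨x, y, ε, η, hxy, hε, hη, hu⟩ := eq_single_add_single_of_sum_sq_eq_two hu2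
      have hη' : η = -ε := by
        rw [hu] at hu0
        simp [Finset.sum_add_distrib] at hu0
        linarith
      subst hη'
      have hε0 : ε ≠ 0 := by rcases hε with rfl | rfl <;> decide
      have hs : ∑ k ∈ P, u c k = (if x ∈ P then ε else 0) + if y ∈ P then -ε else 0 := by
        rw [hu]; simp [Finset.sum_add_distrib, Finset.sum_pi_single']
      rw [hs] at hcc ⊢
      by_cases hx : x ∈ P <;> by_cases hy : y ∈ P <;> simp [hx, hy] at hcc
      · exact ⟨y, hy, by simp [hu, hxy.symm, hε0], by simp [hu, hx, hy, hxy.symm]⟩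
      · exact ⟨x, hx, by simp [hu, hxy, hε0], by simp [hu, hx, hy, hxy]⟩
    have hins : ∀ t, ∑ k ∈ insert y P, u t k = ∑ k ∈ P, u t k + u t y := fun t => by
      rw [Finset.sum_insert hyP, add_comm]
    have hcard : (insert y P).card = p + 2 := by rw [Finset.card_insert_of_notMem hyP, hPc]
    obtain ⟨w, hw⟩ : ∃ w, w ∉ insert y P := by
      by_contra hcon
      push Not at hcon
      have h3 : insert y P = Finset.univ := Finset.eq_univ_iff_forall.mpr hcon
      rw [h3, Finset.card_univ, hA.card] at hcard
      omega
    obtain ⟨c', hc', hcP'⟩ := hA.exists_sum_ne_zero (Finset.mem_insert_self y P) hw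
    have hne : c' ≠ c := by
      rintro rfl
      rw [hins] at hcP'
      exact hcP' hyc.2
    have hc'y : u c' y ≠ 0 := by
      rw [hins, hcut c' hc' hne, zero_add] at hcP'
      exact hcP'
    have hpair : {c, c'} ⊆ edges T u y := by
      intro t ht
      rcases Finset.mem_insert.mp ht with rfl | ht
      · exact mem_edges.mpr ⟨hc, hyc.1⟩
      · rw [Finset.mem_singleton] at ht
        subst ht
        exact mem_edges.mpr ⟨hc', hc'y⟩
    have heq : {c, c'} = edges T u y := Finset.eq_of_subset_of_card_le hpair (by
      rw [Finset.card_pair hne.symm]; exact h2 y)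
    have hyj : y ≠ j := by
      rintro rfl
      rw [← heq, Finset.card_pair hne.symm] at hj
      omega
    refine ⟨insert y P, hcard, Finset.mem_insert_of_mem hiP, ?_, c', hc', fun t ht htc' => ?_⟩
    · simp [hyj.symm, hjP]
    · rw [hins]
      by_cases htc : t = c
      · rw [htc, hyc.2]
      · have : t ∉ edges T u y := by rw [← heq]; simp [htc, htc']
        have : u t y = 0 := by
          by_contra h0
          exact this (mem_edges.mpr ⟨ht, h0⟩)
        rw [hcut t ht htc, this, add_zero]

lemma false_of_sum_sq_eq_two (h : Critical G) (hA : ARep G T u) (h9 : 9 ≤ T.card) {a b : V}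
    {α β : ι → ℤ} (hR : Remainder G T u a b α β) (hα : ∑ k, α k ^ 2 = 2)
    (hβ : ∑ k, β k ^ 2 ≤ 2) : False := by
  have hgt := hR.sum_sq_gt hα.le hβ
  set g := G a b - ∑ k, α k * β k with hg
  have hg0 : g ≠ 0 := by
    intro h0
    rw [h0, hα] at hgt
    simp at hgt
  obtain ⟨i, j, ε, η, hij, hε, hη, hαe⟩ := eq_single_add_single_of_sum_sq_eq_two hα
  have hX : ∀ v, (edges T u v).card = 1 → v ∈ ({i, j} : Finset ι) := by
    intro v hv
    by_contra hvX
    simp only [Finset.mem_insert, Finset.mem_singleton, not_or] at hvX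
    have h1 := hA.leaf_le h9 hR hα.le hβ hv
    have hαv : α v = 0 := by rw [hαe]; simp [hvX.1, hvX.2]
    rw [hα, hαv, ← hg] at h1
    have h2 : g ^ 2 ≤ 0 := by linarith
    exact hg0 (pow_eq_zero_iff two_ne_zero |>.mp (le_antisymm h2 (sq_nonneg g)))
  have hdeg := (hA.two_le_card_leaves h (by omega) hX).2 (Finset.card_pair hij)
  obtain ⟨P, hPc, hiP, hjP, c, hc, hcut⟩ := hA.exists_initial_segment h hij
    (by rw [hdeg]; simp) (by rw [hdeg]; simp) (fun v => by rw [hdeg]; split_ifs <;> omega) 4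
    (by omega)
  have hαi : ∑ k ∈ P, α k = ε := by
    rw [hαe]; simp [Finset.sum_add_distrib, Finset.sum_pi_single', hiP, hjP]
  have hαj : ∑ k ∈ Pᶜ, α k = η := by
    rw [hαe]; simp [Finset.sum_add_distrib, Finset.sum_pi_single', hiP, hjP]
  refine middle_cut_absurd (B := ∑ k, β k ^ 2) (g := g) (v₁ := ε) (v₂ := η)
    (w₁ := ∑ k ∈ P, β k) (w₂ := ∑ k ∈ Pᶜ, β k) hβ ?_ ?_ ?_ hg0 fun s r => ?_
  · rcases hε with rfl | rfl <;> rfl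
  · rcases hη with rfl | rfl <;> rfl
  · have habs : ∀ S : Finset ι, |∑ k ∈ S, β k| ≤ ∑ k ∈ S, β k ^ 2 := fun S =>
      (Finset.abs_sum_le_sum_abs _ _).trans (Finset.sum_le_sum fun k _ => int_abs_le_sq _)
    rw [← Finset.sum_add_sum_compl P fun k => β k ^ 2]
    exact add_le_add (habs P) (habs Pᶜ)
  · have h1 := hA.cut_nonneg hR hiP hjP hc hcut s r
    rw [hα, hαi, hαj, ← hg, hPc] at h1
    have h5 : (5 : ℝ) ≤ (Pᶜ.card : ℝ) := by
      have : 5 ≤ Pᶜ.card := by rw [Finset.card_compl, hA.card, hPc]; omega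
      exact_mod_cast this
    have h2 : (s * (η : ℝ) + r * (∑ k ∈ Pᶜ, β k : ℤ)) ^ 2 / (Pᶜ.card : ℝ)
        ≤ (s * (η : ℝ) + r * (∑ k ∈ Pᶜ, β k : ℤ)) ^ 2 / 5 :=
      div_le_div_of_nonneg_left (sq_nonneg _) (by norm_num) h5
    push_cast at h1 h2 ⊢
    norm_num at h1
    linarith

lemma false_of_nine_le_card (h : Critical G) (hA : ARep G T u) {a b : V} (hab : a ≠ b)
    (ha : a ∉ T) (hb : b ∉ T) (hcov : ∀ v, v ∉ T → v = a ∨ v = b) (h9 : 9 ≤ T.card) : False := by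
  obtain ⟨α, hα, hA2⟩ := hA.functional_int h hab ha hb h9
  obtain ⟨β, hβ, hB2⟩ := hA.functional_int h hab.symm hb ha h9
  have hR : Remainder G T u a b α β := ⟨h, hab, ha, hb, hcov, hA.gram, hα, hβ⟩
  have hgt := hR.sum_sq_gt hA2 hB2
  have hsupp : ∀ γ : ι → ℤ, ∑ k, γ k ^ 2 ≤ 1 →
      ∃ v, (edges T u v).card = 1 ∧ γ v = 0 := by
    intro γ hγ
    by_contra hcon
    push Not at hcon
    have h1 := (hA.two_le_card_leaves h (by omega)
      (X := Finset.univ.filter fun k => γ k ≠ 0) (fun v hv => by simpa using hcon v hv)).1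
    have h2 := card_support_eq_sum_sq (γ := γ) (by omega)
    omega
  have hA0 : 0 ≤ ∑ k, α k ^ 2 := Finset.sum_nonneg fun k _ => sq_nonneg _
  have hB0 : 0 ≤ ∑ k, β k ^ 2 := Finset.sum_nonneg fun k _ => sq_nonneg _
  have hle : ∀ (γ : ι → ℤ) v, γ v ^ 2 ≤ ∑ k, γ k ^ 2 := fun γ v =>
    Finset.single_le_sum (f := fun k => γ k ^ 2) (fun k _ => sq_nonneg _) (Finset.mem_univ v)
  by_cases hAe : ∑ k, α k ^ 2 = 2
  · exact hA.false_of_sum_sq_eq_two h h9 hR hAe hB2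
  by_cases hBe : ∑ k, β k ^ 2 = 2
  · exact hA.false_of_sum_sq_eq_two h h9 hR.swap hBe hA2
  by_cases hAz : ∑ k, α k ^ 2 = 0
  · obtain ⟨v, hv, hβv⟩ := hsupp β (by omega)
    have h1 := hA.leaf_le h9 hR hA2 hB2 hv
    have hαv : α v ^ 2 = 0 := le_antisymm ((hle α v).trans hAz.le) (sq_nonneg _)
    rw [hαv, hβv] at h1
    simp only [mul_zero, add_zero, ne_eq, OfNat.ofNat_ne_zero, not_false_eq_true, zero_pow] at h1
    exact absurd hgt (not_lt.mpr h1)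
  by_cases hBz : ∑ k, β k ^ 2 = 0
  · obtain ⟨v, hv, hαv⟩ := hsupp α (by omega)
    have h1 := hA.leaf_le h9 hR hA2 hB2 hv
    have hβv : β v ^ 2 = 0 := le_antisymm ((hle β v).trans hBz.le) (sq_nonneg _)
    rw [hβv, hαv] at h1
    simp only [zero_mul, add_zero, ne_eq, OfNat.ofNat_ne_zero, not_false_eq_true, zero_pow] at h1
    exact absurd hgt (not_lt.mpr h1)
  have hA1 : ∑ k, α k ^ 2 = 1 := by omega
  have hB1 : ∑ k, β k ^ 2 = 1 := by omega
  obtain ⟨v, hv, hαv⟩ := hsupp α (by omega)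
  have h1 := hA.leaf_le h9 hR hA2 hB2 hv
  have hβv := hle β v
  rw [hB1] at hβv
  rw [hA1, hB1, hαv] at h1
  rw [hA1, hB1] at hgt
  set g := G a b - ∑ k, α k * β k
  have h2 : g ^ 2 ≤ 2 := by
    have : g + 0 * β v = g := by ring
    rw [this] at h1
    linarith
  have h3 : g < 2 := by nlinarith
  have h4 : -2 < g := by nlinarith
  have h5 : g = -1 ∨ g = 0 ∨ g = 1 := by omega
  rcases h5 with h5 | h5 | h5 <;> rw [h5] at hgt <;> norm_num at hgt

end ARep

theorem Critical.card_le_ten (h : Critical G) : Fintype.card V ≤ 10 := by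
  by_contra hcon
  push Not at hcon
  obtain ⟨T, hTc, hT⟩ := h.exists_isADE (Fintype.card V - 3) (by omega)
  have hc : Tᶜ.card = 2 := by rw [Finset.card_compl]; omega
  obtain ⟨a, b, hab, hTab⟩ := Finset.card_eq_two.mp hc
  have hmem : ∀ v, v ∉ T ↔ v = a ∨ v = b := fun v => by
    rw [← Finset.mem_compl, hTab]; simp
  have ha := (hmem a).mpr (Or.inl rfl)
  have hb := (hmem b).mpr (Or.inr rfl)
  rcases hT with ⟨ι, _, _, u, hA⟩ | ⟨ι, _, _, u, hD⟩ | ⟨b, k, hE⟩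
  · exact hA.false_of_nine_le_card h hab ha hb (fun v => (hmem v).mp) (by omega)
  · exact hD.false_of_nine_le_card h hab ha hb (fun v => (hmem v).mp) (by omega)
  · have := hE.card
    have := hE.le_eight
    omega

end TypeA

section Reduction

variable {V : Type} [Fintype V] [DecidableEq V]

/-- An indefinite integral Gram matrix with diagonal `2` has a small negative vector. -/
lemma exists_neg_card_support_le_ten_of_diag_two {G : V → V → ℤ} (hG : ∀ i j, G i j = G j i)
    (hd : ∀ i, G i i = 2) (hneg : ∃ x : V → ℝ, bil G x x < 0) :
    ∃ x : V → ℝ, bil G x x < 0 ∧ (Finset.univ.filter fun v => x v ≠ 0).card ≤ 10 := by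
  classical
  let P : ℕ → Prop := fun s =>
    ∃ x : V → ℝ, bil G x x < 0 ∧ (Finset.univ.filter fun v => x v ≠ 0).card = s
  have hP : ∃ s, P s := by
    obtain ⟨x, hx⟩ := hneg
    exact ⟨_, x, hx, rfl⟩
  obtain ⟨x, hx, hxs⟩ := Nat.find_spec hP
  have hmin : ∀ y : V → ℝ, (Finset.univ.filter fun v => y v ≠ 0).card < Nat.find hP →
      0 ≤ bil G y y := by
    intro y hy
    by_contra hcon
    exact Nat.find_min hP hy ⟨y, not_le.mp hcon, rfl⟩
  refine ⟨x, hx, ?_⟩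
  set W := Finset.univ.filter fun v => x v ≠ 0 with hW
  have hsum : ∀ y : V → ℝ, (∀ v, v ∉ W → y v = 0) →
      bil (fun i j : W => G i j) (fun v : W => y v) (fun v : W => y v) = bil G y y := by
    intro y hy
    rw [bil_apply, bil_apply]
    refine Fintype.sum_of_injective Subtype.val Subtype.val_injective _ _ (fun i hi => ?_) fun i => ?_
    · have : y i = 0 := hy i fun hiW => hi ⟨⟨i, hiW⟩, rfl⟩
      simp [this]
    · refine Fintype.sum_of_injective Subtype.val Subtype.val_injective _ _ (fun j hj => ?_)
        fun j => rfl
      have : y j = 0 := hy j fun hjW => hj ⟨⟨j, hjW⟩, rfl⟩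
      simp [this]
  have hcrit : Critical fun i j : W => G i j := by
    refine ⟨fun i j => hG i j, fun i => hd i, ?_, fun v => x v, ?_⟩
    · rintro y ⟨i, hi⟩
      set z : V → ℝ := fun v => if hv : v ∈ W then y ⟨v, hv⟩ else 0 with hz
      have hzW : ∀ v, v ∉ W → z v = 0 := fun v hv => by simp [hz, hv]
      have hyz : y = fun v : W => z v := by ext v; simp [hz]
      rw [hyz, hsum z hzW]
      refine hmin z ?_
      rw [← hxs]
      refine Finset.card_lt_card ((Finset.ssubset_iff_of_subset fun v hv => ?_).mpr
        ⟨i, i.2, ?_⟩)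
      · by_contra hvW
        exact (Finset.mem_filter.mp hv).2 (hzW v hvW)
      · simp [hz, hi]
    · rw [hsum x fun v hv => by simpa [hW] using hv]
      exact hx
  have := hcrit.card_le_ten
  rwa [Fintype.card_coe] at this

/-- Splitting each vertex of norm `1` into two vertices of norm `2`. -/
def doubled (G : V → V → ℤ) (p q : V × Bool) : ℤ :=
  G p.1 q.1 + if p.1 = q.1 ∧ G p.1 p.1 = 1 then (if p.2 = q.2 then 1 else -1) else 0

lemma bil_doubled (G : V → V → ℤ) (x : V × Bool → ℝ) :
    bil (doubled G) x x
      = bil G (fun v => x (v, true) + x (v, false)) (fun v => x (v, true) + x (v, false))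
        + ∑ v, if G v v = 1 then (x (v, true) - x (v, false)) ^ 2 else 0 := by
  rw [bil_apply, bil_apply, ← Finset.sum_add_distrib, Fintype.sum_prod_type]
  refine Finset.sum_congr rfl fun i _ => ?_
  have h1 : (if G i i = 1 then (x (i, true) - x (i, false)) ^ 2 else 0)
      = ∑ j, if i = j then (if G i i = 1 then (x (i, true) - x (i, false))
        * (x (j, true) - x (j, false)) else 0) else 0 := by
    rw [Finset.sum_ite_eq]; simp [sq]
  rw [h1, ← Finset.sum_add_distrib, Fintype.sum_bool, Fintype.sum_prod_type,
    Fintype.sum_prod_type, ← Finset.sum_add_distrib]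
  refine Finset.sum_congr rfl fun j _ => ?_
  rw [Fintype.sum_bool, Fintype.sum_bool]
  by_cases hij : i = j
  · subst hij
    by_cases hi : G i i = 1
    · simp [doubled, hi]; ring
    · simp [doubled, hi]; ring
  · simp [doubled, hij]; ring

/-- An indefinite integral Gram matrix with diagonal entries `1` or `2` has a small negative
vector. -/
lemma exists_neg_card_support_le_ten {G : V → V → ℤ} (hG : ∀ i j, G i j = G j i)
    (hd : ∀ i, G i i = 1 ∨ G i i = 2) (hneg : ∃ x : V → ℝ, bil G x x < 0) :
    ∃ x : V → ℝ, bil G x x < 0 ∧ (Finset.univ.filter fun v => x v ≠ 0).card ≤ 10 := by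
  obtain ⟨x, hx⟩ := hneg
  obtain ⟨y, hy, hyc⟩ := exists_neg_card_support_le_ten_of_diag_two (G := doubled G)
    (fun p q => by
      by_cases hpq : p.1 = q.1
      · simp [doubled, hpq, eq_comm]
      · simp [doubled, hpq, Ne.symm hpq, hG p.1 q.1])
    (fun p => by rcases hd p.1 with h | h <;> simp [doubled, h])
    ⟨fun p => x p.1 / 2, by rw [bil_doubled]; simpa using hx⟩
  rw [bil_doubled] at hy
  have h1 : 0 ≤ ∑ v, if G v v = 1 then (y (v, true) - y (v, false)) ^ 2 else 0 :=
    Finset.sum_nonneg fun v _ => by split_ifs <;> positivity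
  refine ⟨fun v => y (v, true) + y (v, false), by linarith, le_trans ?_ hyc⟩
  refine (Finset.card_le_card fun v hv => ?_).trans (Finset.card_image_le (f := Prod.fst))
  rw [Finset.mem_filter] at hv
  by_cases hvt : y (v, true) = 0
  · refine Finset.mem_image.mpr ⟨(v, false), ?_, rfl⟩
    simpa [hvt] using hv.2
  · exact Finset.mem_image.mpr ⟨(v, true), by simpa using hvt, rfl⟩

end Reduction

section Eigenvalues

variable {n : Type*} [Fintype n] [DecidableEq n] {A : Matrix n n ℝ} {c : ℝ}

lemma exists_dotProduct_lt_of_iInf_eigenvalues_lt [Nonempty n] (hA : A.IsHermitian)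
    (h : (⨅ i, hA.eigenvalues i) < c) : ∃ x : n → ℝ, x ⬝ᵥ A *ᵥ x < c * (x ⬝ᵥ x) := by
  obtain ⟨i, hi⟩ := exists_lt_of_ciInf_lt h
  refine ⟨(hA.eigenvectorBasis i).ofLp, ?_⟩
  rw [hA.mulVec_eigenvectorBasis, dotProduct_smul, smul_eq_mul]
  refine mul_lt_mul_of_pos_right hi ?_
  have h0 : (hA.eigenvectorBasis i).ofLp ≠ 0 := fun h0 =>
    hA.eigenvectorBasis.orthonormal.ne_zero i (by ext j; exact congrFun h0 j)
  obtain ⟨j, hj⟩ := Function.ne_iff.mp h0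
  exact Finset.sum_pos' (fun k _ => mul_self_nonneg _) ⟨j, Finset.mem_univ j, mul_self_pos.mpr hj⟩

lemma iInf_eigenvalues_lt_of_dotProduct_lt (hA : A.IsHermitian) {x : n → ℝ}
    (h : x ⬝ᵥ A *ᵥ x < c * (x ⬝ᵥ x)) : (⨅ i, hA.eigenvalues i) < c := by
  by_contra hcon
  push Not at hcon
  have hc : ∀ i, c ≤ hA.eigenvalues i := fun i =>
    hcon.trans (ciInf_le (Set.finite_range _).bddBelow i)
  have hB : (A - algebraMap ℝ (Matrix n n ℝ) c).PosSemidef := by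
    rw [posSemidef_iff_isHermitian_and_spectrum_nonneg]
    refine ⟨hA.sub ?_, fun r hr => ?_⟩
    · rw [Algebra.algebraMap_eq_smul_one]
      exact isHermitian_one.smul (IsSelfAdjoint.all c)
    · rw [← spectrum.sub_singleton_eq, hA.spectrum_real_eq_range_eigenvalues] at hr
      obtain ⟨_, ⟨i, rfl⟩, _, rfl, rfl⟩ := hr
      exact sub_nonneg.mpr (hc i)
  have h1 := hB.dotProduct_mulVec_nonneg x
  rw [sub_mulVec, dotProduct_sub, Algebra.algebraMap_eq_smul_one, smul_mulVec, one_mulVec,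
    dotProduct_smul, smul_eq_mul, star_trivial] at h1
  linarith

end Eigenvalues

/-- A real symmetric matrix with diagonal entries `0` or `-1`, integer off-diagonal entries,
and smallest eigenvalue less than `-2` has a principal submatrix of order at most `10` with
smallest eigenvalue less than `-2`. -/
theorem stmt_8 {n : ℕ} (hn : 0 < n) (M : Matrix (Fin n) (Fin n) ℝ)
    (hM : M.IsHermitian)
    (hdiag : ∀ i, M i i = 0 ∨ M i i = -1)
    (hoff : ∀ i j, i ≠ j → ∃ z : ℤ, M i j = z)
    (hmin : (⨅ i, hM.eigenvalues i) < -2) :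
    ∃ (k : ℕ) (_ : k ≤ 10) (f : Fin k ↪ Fin n),
      (⨅ i, (hM.submatrix (f : Fin k → Fin n)).eigenvalues i) < -2 := by
  have hentry : ∀ i j, ∃ z : ℤ, (z : ℝ) = M i j + if i = j then 2 else 0 := by
    intro i j
    by_cases hij : i = j
    · subst hij
      rcases hdiag i with h | h
      · exact ⟨2, by simp [h]⟩
      · exact ⟨1, by simp [h]; norm_num⟩
    · obtain ⟨z, hz⟩ := hoff i j hij
      exact ⟨z, by simp [hz, hij]⟩
  choose G hG using hentry
  have hbil : ∀ x : Fin n → ℝ, bil G x x = x ⬝ᵥ M *ᵥ x + 2 * (x ⬝ᵥ x) := by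
    intro x
    rw [bil_apply]
    simp only [hG, dotProduct, mulVec, Finset.mul_sum, ← Finset.sum_add_distrib]
    refine Finset.sum_congr rfl fun i _ => ?_
    have h1 : 2 * (x i * x i) = ∑ j, if i = j then 2 * (x i * x j) else 0 := by simp
    rw [h1, ← Finset.sum_add_distrib]
    refine Finset.sum_congr rfl fun j _ => ?_
    split_ifs <;> ring
  have hne : Nonempty (Fin n) := ⟨⟨0, hn⟩⟩
  obtain ⟨x₀, hx₀⟩ := exists_dotProduct_lt_of_iInf_eigenvalues_lt hM hmin
  obtain ⟨x, hx, hxc⟩ := exists_neg_card_support_le_ten (G := G)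
    (fun i j => by
      have h1 : M i j = M j i := by simpa using (hM.apply i j).symm
      have h2 : (G i j : ℝ) = G j i := by rw [hG, hG, h1]; simp [eq_comm]
      exact_mod_cast h2)
    (fun i => by
      have h1 := hG i i
      rcases hdiag i with h | h
      · right
        have : (G i i : ℝ) = 2 := by rw [h1, h]; simp
        exact_mod_cast this
      · left
        have : (G i i : ℝ) = 1 := by rw [h1, h]; norm_num
        exact_mod_cast this)
    ⟨x₀, by rw [hbil]; linarith⟩
  set S := Finset.univ.filter fun v => x v ≠ 0 with hS
  set f : Fin S.card ↪ Fin n := (S.orderEmbOfFin rfl).toEmbedding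
  have hf : ∀ i, i ∉ Set.range f → x i = 0 := by
    intro i hi
    by_contra h0
    refine hi ?_
    have : i ∈ Set.range (S.orderEmbOfFin rfl) := by
      rw [Finset.range_orderEmbOfFin]; simp [hS, h0]
    exact this
  refine ⟨S.card, hxc, f, iInf_eigenvalues_lt_of_dotProduct_lt _ (x := x ∘ f) ?_⟩
  have h1 : (x ∘ f) ⬝ᵥ M.submatrix f f *ᵥ (x ∘ f) = x ⬝ᵥ M *ᵥ x := by
    refine Fintype.sum_of_injective f f.injective _ _ (fun i hi => by simp [hf i hi]) fun i => ?_
    simp only [Function.comp_apply]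
    congr 1
    exact Fintype.sum_of_injective f f.injective _ _ (fun j hj => by simp [hf j hj]) fun j => rfl
  have h2 : (x ∘ f) ⬝ᵥ (x ∘ f) = x ⬝ᵥ x :=
    Fintype.sum_of_injective f f.injective _ _ (fun i hi => by simp [hf i hi]) fun i => rfl
  rw [hbil] at hx
  rw [h1, h2]
  linarith
end

section
/- Every irreducible root lattice (A_n, D_n, E₆, E₇, E₈) is 2-integrable; consequently, any integral lattice that is a direct sum of a standard lattice ℤ^k and irreducible root lattices is 2-integrable. -/
open Matrix

/-- An integral lattice `Λ ⊆ ι → ℝ` is `s`-integrable if `√s · Λ` embeds isometrically into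
a standard lattice `ℤ^k`: i.e. there is a `ℤ`-linear map into `Fin k → ℝ` taking integer
values whose Gram pairing is `s` times the original one. -/
def IsSIntegrable {ι : Type*} [Fintype ι] (s : ℕ) (Λ : Submodule ℤ (ι → ℝ)) : Prop :=
  ∃ (k : ℕ) (f : Λ →ₗ[ℤ] (Fin k → ℝ)),
    (∀ v : Λ, ∀ i, ∃ z : ℤ, f v i = z) ∧
    ∀ v w : Λ, (f v) ⬝ᵥ (f w) = (s : ℝ) * ((v : ι → ℝ) ⬝ᵥ (w : ι → ℝ))

/-- The root lattice `A_n`, generated by the roots `e_i - e_j`. -/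
def Alat (n : ℕ) : Submodule ℤ (Fin (n + 1) → ℝ) :=
  Submodule.span ℤ
    {x | ∃ i j : Fin (n + 1), i ≠ j ∧ x = Pi.single i 1 - Pi.single j 1}

/-- The root lattice `D_n`, generated by the roots `±e_i ± e_j`. -/
def Dlat (n : ℕ) : Submodule ℤ (Fin n → ℝ) :=
  Submodule.span ℤ
    {x | ∃ i j : Fin n, i ≠ j ∧
      (x = Pi.single i 1 - Pi.single j 1 ∨ x = Pi.single i 1 + Pi.single j 1)}

/-- The root lattice `E₈ = D₈ ∪ (c + D₈)` with `c = (1/2, …, 1/2)`. -/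
def E8lat : Submodule ℤ (Fin 8 → ℝ) :=
  Dlat 8 ⊔ Submodule.span ℤ {fun _ => (1 / 2 : ℝ)}

/-- The root lattice `E₇ = {x ∈ E₈ ∣ ∑ xᵢ = 0}`. -/
def E7lat : Submodule ℤ (Fin 8 → ℝ) :=
  E8lat ⊓ (LinearMap.ker (∑ i, LinearMap.proj (R := ℤ) (φ := fun _ : Fin 8 => ℝ) i))

/-- The root lattice `E₆ = {x ∈ E₇ ∣ x₇ + x₈ = 0}` (coordinates indexed from `0`). -/
def E6lat : Submodule ℤ (Fin 8 → ℝ) :=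
  E7lat ⊓ (LinearMap.ker
    (LinearMap.proj (R := ℤ) (φ := fun _ : Fin 8 => ℝ) 6 +
      LinearMap.proj (R := ℤ) (φ := fun _ : Fin 8 => ℝ) 7))

/-- The standard lattice `ℤ^k ⊆ ℝ^k`. -/
def Zlat (k : ℕ) : Submodule ℤ (Fin k → ℝ) :=
  Submodule.span ℤ (Set.range fun i : Fin k => (Pi.single i 1 : Fin k → ℝ))

/-- The orthogonal direct sum of two lattices. -/
def dirSum {ι ι' : Type*} [Fintype ι] [Fintype ι']
    (Λ : Submodule ℤ (ι → ℝ)) (Λ' : Submodule ℤ (ι' → ℝ)) :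
    Submodule ℤ ((ι ⊕ ι') → ℝ) :=
  (Λ.prod Λ').comap
    ((LinearMap.funLeft ℤ ℝ Sum.inl).prod (LinearMap.funLeft ℤ ℝ Sum.inr))

theorem IsSIntegrable.of_fintype {ι κ : Type*} [Fintype ι] [Fintype κ] {s : ℕ}
    {Λ : Submodule ℤ (ι → ℝ)} (f : Λ →ₗ[ℤ] (κ → ℝ))
    (hint : ∀ v i, ∃ z : ℤ, f v i = z)
    (hf : ∀ v w : Λ, f v ⬝ᵥ f w = (s : ℝ) * ((v : ι → ℝ) ⬝ᵥ (w : ι → ℝ))) :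
    IsSIntegrable s Λ := by
  let e := Fintype.equivFin κ
  refine ⟨Fintype.card κ, LinearMap.funLeft ℤ ℝ e.symm ∘ₗ f, fun v i => hint v (e.symm i),
    fun v w => ?_⟩
  rw [← hf v w]
  exact Equiv.sum_comp e.symm fun i => f v i * f w i

theorem IsSIntegrable.mono {ι : Type*} [Fintype ι] {s : ℕ} {Λ Λ' : Submodule ℤ (ι → ℝ)}
    (h : Λ ≤ Λ') : IsSIntegrable s Λ' → IsSIntegrable s Λ := by
  rintro ⟨k, f, hint, hf⟩
  exact ⟨k, f ∘ₗ Submodule.inclusion h, fun v => hint _, fun v w => hf _ _⟩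

theorem IsSIntegrable.dirSum {ι ι' : Type*} [Fintype ι] [Fintype ι'] {s : ℕ}
    {Λ : Submodule ℤ (ι → ℝ)} {Λ' : Submodule ℤ (ι' → ℝ)} :
    IsSIntegrable s Λ → IsSIntegrable s Λ' → IsSIntegrable s (dirSum Λ Λ') := by
  rintro ⟨k, f, hint, hf⟩ ⟨k', f', hint', hf'⟩
  let p : _root_.dirSum Λ Λ' →ₗ[ℤ] Λ :=
    (LinearMap.funLeft ℤ ℝ Sum.inl).restrict fun _ hv => hv.1
  let p' : _root_.dirSum Λ Λ' →ₗ[ℤ] Λ' :=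
    (LinearMap.funLeft ℤ ℝ Sum.inr).restrict fun _ hv => hv.2
  refine .of_fintype (κ := Fin k ⊕ Fin k')
    (LinearMap.pi (Sum.elim (fun i => LinearMap.proj i ∘ₗ f ∘ₗ p)
      fun i => LinearMap.proj i ∘ₗ f' ∘ₗ p')) ?_ fun v w => ?_
  · rintro v (i | i)
    · exact hint _ i
    · exact hint' _ i
  · have h := hf (p v) (p w)
    have h' := hf' (p' v) (p' w)
    simp only [dotProduct, Fintype.sum_sum_type, mul_add] at h h' ⊢
    exact congrArg₂ (· + ·) h h'

theorem exists_int_of_mem_Zlat {k : ℕ} {v : Fin k → ℝ} (hv : v ∈ Zlat k) (i : Fin k) :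
    ∃ z : ℤ, v i = z := by
  induction hv using Submodule.span_induction with
  | mem x hx =>
    obtain ⟨j, rfl⟩ := hx
    exact ⟨Pi.single (M := fun _ => ℤ) j 1 i, by simp [Pi.single_apply]⟩
  | zero => exact ⟨0, by simp⟩
  | add x y _ _ hx hy =>
    obtain ⟨a, ha⟩ := hx
    obtain ⟨b, hb⟩ := hy
    exact ⟨a + b, by simp [ha, hb]⟩
  | smul c x _ hx =>
    obtain ⟨a, ha⟩ := hx
    exact ⟨c * a, by simp [ha]⟩

theorem isSIntegrable_Zlat (s k : ℕ) : IsSIntegrable s (Zlat k) := by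
  refine .of_fintype (κ := Fin s × Fin k)
    (LinearMap.funLeft ℤ ℝ Prod.snd ∘ₗ (Zlat k).subtype)
    (fun v i => exists_int_of_mem_Zlat v.2 i.2) fun v w => ?_
  simp [dotProduct, Fintype.sum_prod_type, LinearMap.funLeft_apply]

theorem single_mem_Zlat {k : ℕ} (i : Fin k) : Pi.single i 1 ∈ Zlat k :=
  Submodule.subset_span ⟨i, rfl⟩

theorem Alat_le_Zlat (n : ℕ) : Alat n ≤ Zlat (n + 1) := by
  refine Submodule.span_le.2 ?_
  rintro _ ⟨i, j, -, rfl⟩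
  exact sub_mem (single_mem_Zlat i) (single_mem_Zlat j)

theorem Dlat_le_Zlat (n : ℕ) : Dlat n ≤ Zlat n := by
  refine Submodule.span_le.2 ?_
  rintro _ ⟨i, j, -, rfl | rfl⟩
  · exact sub_mem (single_mem_Zlat i) (single_mem_Zlat j)
  · exact add_mem (single_mem_Zlat i) (single_mem_Zlat j)

/-- The similarity of norm `2` sending `x` to the sums and differences `xᵢ ± xᵢ₊₄`. -/
def sumDiff : (Fin 8 → ℝ) →ₗ[ℤ] (Fin 4 ⊕ Fin 4 → ℝ) :=
  LinearMap.pi (Sum.elim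
    (fun i => .proj (φ := fun _ : Fin 8 => ℝ) (Fin.castAdd 4 i) + .proj (Fin.natAdd 4 i))
    fun i => .proj (φ := fun _ : Fin 8 => ℝ) (Fin.castAdd 4 i) - .proj (Fin.natAdd 4 i))

@[simp]
theorem sumDiff_inl (v : Fin 8 → ℝ) (i : Fin 4) :
    sumDiff v (Sum.inl i) = v (Fin.castAdd 4 i) + v (Fin.natAdd 4 i) := rfl

@[simp]
theorem sumDiff_inr (v : Fin 8 → ℝ) (i : Fin 4) :
    sumDiff v (Sum.inr i) = v (Fin.castAdd 4 i) - v (Fin.natAdd 4 i) := rfl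

theorem sumDiff_dotProduct (v w : Fin 8 → ℝ) : sumDiff v ⬝ᵥ sumDiff w = 2 * (v ⬝ᵥ w) := by
  have h : v ⬝ᵥ w = ∑ i : Fin 4, v (Fin.castAdd 4 i) * w (Fin.castAdd 4 i) +
      ∑ i : Fin 4, v (Fin.natAdd 4 i) * w (Fin.natAdd 4 i) :=
    Fin.sum_univ_add (a := 4) (b := 4) fun i => v i * w i
  rw [h, ← Finset.sum_add_distrib, dotProduct, Fintype.sum_sum_type, ← Finset.sum_add_distrib,
    Finset.mul_sum]
  refine Finset.sum_congr rfl fun i _ => ?_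
  simp only [sumDiff_inl, sumDiff_inr]
  ring

theorem exists_int_sumDiff {v : Fin 8 → ℝ} (hv : v ∈ E8lat) (i : Fin 4 ⊕ Fin 4) :
    ∃ z : ℤ, sumDiff v i = z := by
  obtain ⟨x, hx, y, hy, rfl⟩ := Submodule.mem_sup.1 hv
  obtain ⟨c, rfl⟩ := Submodule.mem_span_singleton.1 hy
  have hint := exists_int_of_mem_Zlat (Dlat_le_Zlat 8 hx)
  rcases i with i | i <;> obtain ⟨a, ha⟩ := hint (Fin.castAdd 4 i) <;>
    obtain ⟨b, hb⟩ := hint (Fin.natAdd 4 i)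
  · refine ⟨a + b + c, ?_⟩
    simp only [sumDiff_inl, Pi.add_apply, zsmul_eq_mul, Pi.mul_apply, Pi.intCast_apply, ha, hb]
    push_cast
    ring
  · refine ⟨a - b, ?_⟩
    simp only [sumDiff_inr, Pi.add_apply, zsmul_eq_mul, Pi.mul_apply, Pi.intCast_apply, ha, hb]
    push_cast
    ring

theorem isSIntegrable_two_E8lat : IsSIntegrable 2 E8lat :=
  .of_fintype (sumDiff ∘ₗ E8lat.subtype) (fun v i => exists_int_sumDiff v.2 i) fun v w => by
    simpa using sumDiff_dotProduct v w

/-- Every irreducible root lattice (`A_n`, `D_n`, `E₆`, `E₇`, `E₈`) is `2`-integrable;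
the standard lattice is `2`-integrable; and `2`-integrability is preserved by direct sums,
so any direct sum of a standard lattice and irreducible root lattices is `2`-integrable. -/
theorem stmt_19 :
    (∀ n : ℕ, IsSIntegrable 2 (Alat n)) ∧
    (∀ n : ℕ, IsSIntegrable 2 (Dlat n)) ∧
    IsSIntegrable 2 E8lat ∧ IsSIntegrable 2 E7lat ∧ IsSIntegrable 2 E6lat ∧
    (∀ k : ℕ, IsSIntegrable 2 (Zlat k)) ∧
    (∀ (ι ι' : Type) [Fintype ι] [Fintype ι']
      (Λ : Submodule ℤ (ι → ℝ)) (Λ' : Submodule ℤ (ι' → ℝ)),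
      IsSIntegrable 2 Λ → IsSIntegrable 2 Λ' → IsSIntegrable 2 (dirSum Λ Λ')) := by
  have hE7 : IsSIntegrable 2 E7lat := isSIntegrable_two_E8lat.mono inf_le_left
  exact ⟨fun n => (isSIntegrable_Zlat 2 _).mono (Alat_le_Zlat n),
    fun n => (isSIntegrable_Zlat 2 n).mono (Dlat_le_Zlat n),
    isSIntegrable_two_E8lat, hE7, hE7.mono inf_le_left, isSIntegrable_Zlat 2,
    fun _ _ _ _ _ _ => IsSIntegrable.dirSum⟩
end
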